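/- Let g be a nonnegative multiplicative function with g(n) ≪ n^α for some α < 1/2 and ∑_{p≤w} g(p)(log p)/p = κ log w + O(1) for a real κ ≥ 0. Then uniformly for all x ≥ 2 and all positive integers q, ∑_{n≤x, (n,q)=1} g(n)/n = c_q(g)(log x)^κ + O(δ(q)(log x)^{κ−1}), where c_q(g) = c(g) ∏_{p∣q} (1 + g(p)/p + g(p²)/p² + ⋯)^{-1} and δ(q) = 1 + ∑_{p∣q} g(p)(log p)/p. -/

import Mathlib

open Finset Filter

/-- Nonnegative multiplicative functions on `ℕ` whose values at prime powers satisfy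
`h (p ^ k) ≤ C p ^ (-β k)`. -/
structure IsPowBoundedMul (h : ℕ → ℝ) (C β : ℝ) : Prop where
  zero : h 0 = 0
  one : h 1 = 1
  mul : ∀ {m n : ℕ}, Nat.Coprime m n → h (m * n) = h m * h n
  nonneg : ∀ n, 0 ≤ h n
  pow_le : ∀ p : ℕ, p.Prime → ∀ k : ℕ, h (p ^ k) ≤ C * ((p : ℝ) ^ (-β)) ^ k

/-- The summatory function of `h` over `1, …, N`. -/
def summatory (h : ℕ → ℝ) (N : ℕ) : ℝ := ∑ n ∈ Icc 1 N, h n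

namespace IsPowBoundedMul

variable {h : ℕ → ℝ} {C β : ℝ}

lemma one_le_const (hh : IsPowBoundedMul h C β) : 1 ≤ C := by
  have := hh.pow_le 2 Nat.prime_two 0
  simpa [hh.one] using this

lemma summatory_nonneg (hh : IsPowBoundedMul h C β) (N : ℕ) : 0 ≤ summatory h N :=
  sum_nonneg fun n _ => hh.nonneg n

lemma summatory_mono (hh : IsPowBoundedMul h C β) : Monotone (summatory h) := fun _ _ hMN =>
  sum_le_sum_of_subset_of_nonneg (Icc_subset_Icc_right hMN) fun n _ _ => hh.nonneg n

lemma apply_eq_ordProj_mul (hh : IsPowBoundedMul h C β) {p : ℕ} (hp : p.Prime) {n : ℕ}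
    (hn : n ≠ 0) :
    h n = h (p ^ n.factorization p) * h (n / p ^ n.factorization p) := by
  rw [← hh.mul ((Nat.coprime_ordCompl hp hn).pow_left _), Nat.ordProj_mul_ordCompl_eq_self]

/-- Weighting by a function of the `p`-adic valuation costs at most the corresponding
sum over powers of `p`. -/
lemma sum_mul_factorization_le (hh : IsPowBoundedMul h C β) {p : ℕ} (hp : p.Prime)
    {φ : ℕ → ℝ} (hφ : ∀ k, 0 ≤ φ k) (hs : Summable fun k => φ k * h (p ^ k)) (N : ℕ) :
    ∑ n ∈ Icc 1 N, h n * φ (n.factorization p)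
      ≤ summatory h N * ∑' k, φ k * h (p ^ k) := by
  have hmaps : ∀ n ∈ Icc 1 N, n.factorization p ∈ range (N + 1) := by
    intro n hn
    rw [mem_Icc] at hn
    have := Nat.factorization_lt (n := n) p (by lia)
    simp only [mem_range]; lia
  rw [← sum_fiberwise_of_maps_to hmaps]
  have hfib : ∀ k ∈ range (N + 1),
      ∑ n ∈ (Icc 1 N).filter (fun n => n.factorization p = k), h n * φ (n.factorization p)
        ≤ summatory h N * (φ k * h (p ^ k)) := by
    intro k _
    have h1 : ∑ n ∈ (Icc 1 N).filter (fun n => n.factorization p = k),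
        h n * φ (n.factorization p)
        = φ k * h (p ^ k) *
          ∑ n ∈ (Icc 1 N).filter (fun n => n.factorization p = k), h (n / p ^ k) := by
      rw [mul_sum]
      refine sum_congr rfl fun n hn => ?_
      simp only [mem_filter, mem_Icc] at hn
      rw [hh.apply_eq_ordProj_mul hp (show n ≠ 0 by lia), hn.2]
      ring
    rw [h1, mul_comm]
    refine mul_le_mul_of_nonneg_right ?_ (mul_nonneg (hφ k) (hh.nonneg _))
    have hdvd : ∀ n ∈ (Icc 1 N).filter (fun n => n.factorization p = k), p ^ k ∣ n := by
      intro n hn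
      simp only [mem_filter] at hn
      rw [← hn.2]
      exact Nat.ordProj_dvd n p
    have hinj : Set.InjOn (fun n : ℕ => n / p ^ k)
        ((Icc 1 N).filter (fun n => n.factorization p = k)) := by
      intro a ha b hb hab
      have := congrArg (fun t => p ^ k * t) hab
      simpa [Nat.mul_div_cancel' (hdvd a ha), Nat.mul_div_cancel' (hdvd b hb)] using this
    rw [← sum_image (f := h) hinj]
    refine sum_le_sum_of_subset_of_nonneg ?_ fun n _ _ => hh.nonneg n
    intro m hm
    obtain ⟨n, hn, rfl⟩ := mem_image.1 hm
    have hd := hdvd n hn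
    simp only [mem_filter, mem_Icc] at hn ⊢
    exact ⟨Nat.div_pos (Nat.le_of_dvd (by lia) hd) (pow_pos hp.pos _),
      (Nat.div_le_self _ _).trans hn.1.2⟩
  refine (sum_le_sum hfib).trans ?_
  rw [← mul_sum]
  exact mul_le_mul_of_nonneg_left
    (hs.sum_le_tsum _ fun k _ => mul_nonneg (hφ k) (hh.nonneg _)) (hh.summatory_nonneg N)

end IsPowBoundedMul

lemma rpow_neg_prime_le {β : ℝ} (hβ : 0 < β) {p : ℕ} (hp : p.Prime) :
    (p : ℝ) ^ (-β) ≤ (2 : ℝ) ^ (-β) :=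
  Real.rpow_le_rpow_of_nonpos (by norm_num) (by exact_mod_cast hp.two_le) (by linarith)

lemma two_rpow_neg_lt_one {β : ℝ} (hβ : 0 < β) : (2 : ℝ) ^ (-β) < 1 :=
  Real.rpow_lt_one_of_one_lt_of_neg (by norm_num) (by linarith)

lemma summable_natCast_mul_two_rpow {β : ℝ} (hβ : 0 < β) :
    Summable fun k : ℕ => (k : ℝ) * ((2 : ℝ) ^ (-β)) ^ k := by
  have := summable_pow_mul_geometric_of_norm_lt_one (R := ℝ) 1 (r := (2 : ℝ) ^ (-β))
    (by rw [Real.norm_of_nonneg (by positivity)]; exact two_rpow_neg_lt_one hβ)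
  simpa using this

/-- The constant bounding the sums over prime powers with exponent at least `j`. -/
noncomputable def tailConst (C β : ℝ) (j : ℕ) : ℝ :=
  C * (((2 : ℝ) ^ (-β)) ^ j)⁻¹ * ∑' k : ℕ, (k : ℝ) * ((2 : ℝ) ^ (-β)) ^ k

lemma tailConst_nonneg {C β : ℝ} (hC : 0 ≤ C) (j : ℕ) : 0 ≤ tailConst C β j := by
  have : 0 ≤ ∑' k : ℕ, (k : ℝ) * ((2 : ℝ) ^ (-β)) ^ k := tsum_nonneg fun k => by positivity
  unfold tailConst
  positivity

namespace IsPowBoundedMul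

variable {h : ℕ → ℝ} {C β : ℝ}

lemma mul_pow_le (hh : IsPowBoundedMul h C β) (hβ : 0 < β) {p : ℕ} (hp : p.Prime)
    {φ : ℕ → ℝ} {j : ℕ} (hφ : ∀ k, φ k ≤ k) (hφj : ∀ k < j, φ k = 0) (k : ℕ) :
    φ k * h (p ^ k) ≤ C * (((2 : ℝ) ^ (-β)) ^ j)⁻¹ * ((p : ℝ) ^ (-β)) ^ j *
      ((k : ℝ) * ((2 : ℝ) ^ (-β)) ^ k) := by
  have hC : 0 ≤ C := zero_le_one.trans hh.one_le_const
  have hρ : 0 < (2 : ℝ) ^ (-β) := by positivity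
  have hpp : 0 < (p : ℝ) := by exact_mod_cast hp.pos
  have ht : 0 < (p : ℝ) ^ (-β) := by positivity
  have htρ := rpow_neg_prime_le hβ hp
  have hpow := hh.pow_le p hp k
  set ρ := (2 : ℝ) ^ (-β)
  set t := (p : ℝ) ^ (-β)
  rcases lt_or_ge k j with hkj | hkj
  · rw [hφj k hkj, zero_mul]; positivity
  · obtain ⟨i, rfl⟩ := Nat.exists_eq_add_of_le hkj
    have e : C * (ρ ^ j)⁻¹ * t ^ j * (((j + i : ℕ) : ℝ) * ρ ^ (j + i))
        = ((j + i : ℕ) : ℝ) * (C * (t ^ j * ρ ^ i)) := by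
      rw [pow_add]; field_simp
    rw [e]
    refine mul_le_mul (hφ _) (hpow.trans ?_) (hh.nonneg _) (Nat.cast_nonneg _)
    rw [pow_add]
    gcongr

lemma summable_mul_pow (hh : IsPowBoundedMul h C β) (hβ : 0 < β) {p : ℕ} (hp : p.Prime)
    {φ : ℕ → ℝ} (hφ0 : ∀ k, 0 ≤ φ k) (hφ : ∀ k, φ k ≤ k) :
    Summable fun k => φ k * h (p ^ k) :=
  Summable.of_nonneg_of_le (fun k => mul_nonneg (hφ0 k) (hh.nonneg _))
    (hh.mul_pow_le hβ hp (j := 0) hφ (by simp))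
    ((summable_natCast_mul_two_rpow hβ).mul_left _)

lemma tsum_mul_pow_le (hh : IsPowBoundedMul h C β) (hβ : 0 < β) {p : ℕ} (hp : p.Prime)
    {φ : ℕ → ℝ} {j : ℕ} (hφ0 : ∀ k, 0 ≤ φ k) (hφ : ∀ k, φ k ≤ k)
    (hφj : ∀ k < j, φ k = 0) :
    ∑' k, φ k * h (p ^ k) ≤ tailConst C β j * ((p : ℝ) ^ (-β)) ^ j := by
  refine ((hh.summable_mul_pow hβ hp hφ0 hφ).tsum_le_tsum (hh.mul_pow_le hβ hp hφ hφj)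
    ((summable_natCast_mul_two_rpow hβ).mul_left _)).trans_eq ?_
  rw [tsum_mul_left, tailConst]
  ring

/-- Replacing the multiples of `p`, weighted by the `p`-adic valuation, by all numbers
up to `N / p`. -/
lemma abs_sum_mul_factorization_sub_le (hh : IsPowBoundedMul h C β) (hβ : 0 < β)
    {p : ℕ} (hp : p.Prime) (N : ℕ) :
    |∑ n ∈ Icc 1 N, h n * n.factorization p - h p * summatory h (N / p)|
      ≤ summatory h N *
        ((tailConst C β 2 + C * tailConst C β 1) * ((p : ℝ) ^ (-β)) ^ 2) := by
  set φ₁ : ℕ → ℝ := fun k => if 1 ≤ k then 1 else 0 with hφ₁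
  set φ₂ : ℕ → ℝ := fun k => if 2 ≤ k then (k : ℝ) else 0 with hφ₂
  have h10 : ∀ k, 0 ≤ φ₁ k := fun k => by simp only [hφ₁]; split_ifs <;> simp
  have h20 : ∀ k, 0 ≤ φ₂ k := fun k => by simp only [hφ₂]; split_ifs <;> simp
  have h1k : ∀ k, φ₁ k ≤ k := fun k => by
    simp only [hφ₁]; split_ifs with hk
    · exact_mod_cast hk
    · simp
  have h2k : ∀ k, φ₂ k ≤ k := fun k => by simp only [hφ₂]; split_ifs <;> simp
  have hsplit : ∑ n ∈ Icc 1 N, h n * n.factorization p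
      = ∑ n ∈ (Icc 1 N).filter (fun n => n.factorization p = 1), h n
        + ∑ n ∈ Icc 1 N, h n * φ₂ (n.factorization p) := by
    rw [sum_filter, ← sum_add_distrib]
    refine sum_congr rfl fun n _ => ?_
    simp only [hφ₂]
    rcases (show n.factorization p = 0 ∨ n.factorization p = 1 ∨ 2 ≤ n.factorization p by lia)
      with hv | hv | hv
    · simp [hv]
    · simp [hv]
    · simp [hv, show n.factorization p ≠ 1 by lia]
  have hone : ∑ n ∈ (Icc 1 N).filter (fun n => n.factorization p = 1), h n
      = h p * ∑ m ∈ (Icc 1 (N / p)).filter (fun m => m.factorization p = 0), h m := by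
    rw [mul_sum]
    refine (sum_nbij' (fun n => n / p) (fun m => p * m) ?_ ?_ ?_ ?_ ?_)
    · intro n hn
      simp only [mem_filter, mem_Icc] at hn ⊢
      have hd : p ∣ n := by
        have := Nat.ordProj_dvd n p
        rwa [hn.2, pow_one] at this
      refine ⟨⟨Nat.div_pos (Nat.le_of_dvd (by lia) hd) hp.pos,
        Nat.div_le_div_right hn.1.2⟩, ?_⟩
      rw [Nat.factorization_div hd]
      simp [hn.2, hp.factorization_self]
    · intro m hm
      simp only [mem_filter, mem_Icc] at hm ⊢
      refine ⟨⟨Nat.mul_pos hp.pos (by lia), ?_⟩, ?_⟩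
      · rw [mul_comm]; exact (Nat.le_div_iff_mul_le hp.pos).1 hm.1.2
      · rw [Nat.factorization_mul hp.ne_zero (by lia)]
        simp [hm.2, hp.factorization_self]
    · intro n hn
      simp only [mem_filter, mem_Icc] at hn
      have hd : p ∣ n := by
        have := Nat.ordProj_dvd n p
        rwa [hn.2, pow_one] at this
      exact Nat.mul_div_cancel' hd
    · intro m _
      exact Nat.mul_div_cancel_left m hp.pos
    · intro n hn
      simp only [mem_filter, mem_Icc] at hn
      rw [hh.apply_eq_ordProj_mul hp (show n ≠ 0 by lia), hn.2, pow_one]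
  have hzero : ∑ m ∈ (Icc 1 (N / p)).filter (fun m => m.factorization p = 0), h m
      = summatory h (N / p) - ∑ m ∈ Icc 1 (N / p), h m * φ₁ (m.factorization p) := by
    rw [sum_filter, summatory, ← sum_sub_distrib]
    refine sum_congr rfl fun m _ => ?_
    simp only [hφ₁]
    rcases Nat.eq_zero_or_pos (m.factorization p) with hv | hv
    · simp [hv]
    · rw [if_neg hv.ne', if_pos (by lia)]; ring
  have hX2 := (hh.sum_mul_factorization_le hp h20 (hh.summable_mul_pow hβ hp h20 h2k) N).trans
    (mul_le_mul_of_nonneg_left (hh.tsum_mul_pow_le hβ hp (j := 2) h20 h2k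
      (fun k hk => by simp [hφ₂, hk])) (hh.summatory_nonneg N))
  have hX1 := ((hh.sum_mul_factorization_le hp h10 (hh.summable_mul_pow hβ hp h10 h1k)
    (N / p)).trans
    (mul_le_mul_of_nonneg_left (hh.tsum_mul_pow_le hβ hp (j := 1) h10 h1k
      (fun k hk => by simp only [hφ₁]; rw [if_neg (by lia)])) (hh.summatory_nonneg _))).trans
    (mul_le_mul_of_nonneg_right (hh.summatory_mono (Nat.div_le_self N p))
      (mul_nonneg (tailConst_nonneg (zero_le_one.trans hh.one_le_const) _) (by positivity)))
  have hX20 : 0 ≤ ∑ n ∈ Icc 1 N, h n * φ₂ (n.factorization p) :=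
    sum_nonneg fun n _ => mul_nonneg (hh.nonneg n) (h20 _)
  have hX10 : 0 ≤ ∑ m ∈ Icc 1 (N / p), h m * φ₁ (m.factorization p) :=
    sum_nonneg fun n _ => mul_nonneg (hh.nonneg n) (h10 _)
  have hhp : h p ≤ C * (p : ℝ) ^ (-β) := by simpa using hh.pow_le p hp 1
  have hprod := mul_le_mul hhp hX1 hX10 ((hh.nonneg p).trans hhp)
  have hprod0 := mul_nonneg (hh.nonneg p) hX10
  rw [hsplit, hone, hzero, abs_le]
  constructor <;> nlinarith

end IsPowBoundedMul

lemma summable_log_mul_rpow_neg_sq {β : ℝ} (hβ : 1 / 2 < β) :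
    Summable fun n : ℕ => Real.log n * ((n : ℝ) ^ (-β)) ^ 2 := by
  set ε := (2 * β - 1) / 2 with hε
  have hε0 : 0 < ε := by rw [hε]; linarith
  have hs : Summable fun n : ℕ => ε⁻¹ * (n : ℝ) ^ (ε + -β * 2) :=
    (Real.summable_nat_rpow.2 (by rw [hε]; linarith)).mul_left _
  refine Summable.of_nonneg_of_le (fun n => mul_nonneg (Real.log_natCast_nonneg n) (by positivity))
    (fun n => ?_) hs
  rcases Nat.eq_zero_or_pos n with rfl | hn
  · simp; positivity
  · have hn' : (0 : ℝ) < n := by exact_mod_cast hn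
    have h1 := Real.log_le_rpow_div hn'.le hε0
    rw [Real.rpow_add hn', ← Real.rpow_natCast, ← Real.rpow_mul hn'.le, Nat.cast_ofNat]
    calc _ ≤ (n : ℝ) ^ ε / ε * (n : ℝ) ^ (-β * 2) := by gcongr
      _ = _ := by ring

/-- The total contribution of the prime powers to the recursion for `∑ h n log n`. -/
noncomputable def primePowConst (C β : ℝ) : ℝ :=
  (tailConst C β 2 + C * tailConst C β 1) *
    ∑' n : ℕ, Real.log n * ((n : ℝ) ^ (-β)) ^ 2

lemma primePowConst_nonneg {C β : ℝ} (hC : 0 ≤ C) : 0 ≤ primePowConst C β := by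
  have h1 := tailConst_nonneg (β := β) hC 1
  have h2 := tailConst_nonneg (β := β) hC 2
  have h3 : 0 ≤ ∑' n : ℕ, Real.log n * ((n : ℝ) ^ (-β)) ^ 2 :=
    tsum_nonneg fun n => mul_nonneg (Real.log_natCast_nonneg n) (by positivity)
  unfold primePowConst
  positivity

lemma sum_log_mul_eq_sum_prime (h : ℕ → ℝ) (N : ℕ) :
    ∑ n ∈ Icc 1 N, h n * Real.log n
      = ∑ p ∈ (Icc 1 N).filter Nat.Prime,
          Real.log p * ∑ n ∈ Icc 1 N, h n * n.factorization p := by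
  have : ∀ n ∈ Icc 1 N, h n * Real.log n
      = ∑ p ∈ (Icc 1 N).filter Nat.Prime, Real.log p * (h n * n.factorization p) := by
    intro n hn
    rw [mem_Icc] at hn
    rw [Real.log_nat_eq_sum_factorization, Finsupp.sum, mul_sum]
    refine (sum_congr rfl fun p _ => ?_).trans (sum_subset (fun p hp => ?_) fun p _ hp => ?_)
    · ring
    · rw [Nat.support_factorization, Nat.mem_primeFactors] at hp
      have := Nat.le_of_dvd (by lia) hp.2.1
      simp only [mem_filter, mem_Icc]
      exact ⟨⟨hp.1.one_le, by lia⟩, hp.1⟩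
    · rw [Finsupp.notMem_support_iff] at hp
      simp [hp]
  rw [sum_congr rfl this, sum_comm]
  simp_rw [mul_sum]

namespace IsPowBoundedMul

variable {h : ℕ → ℝ} {C β : ℝ}

/-- The approximate recursion `∑ h n log n ≈ κ ∑ h n log (x / n)`. -/
lemma abs_sum_log_sub_le (hh : IsPowBoundedMul h C β) (hβ : 1 / 2 < β) {κ A : ℝ}
    (hA : ∀ w : ℝ, 1 ≤ w →
      |∑ p ∈ (Icc 1 ⌊w⌋₊).filter Nat.Prime, h p * Real.log p - κ * Real.log w| ≤ A)
    (x : ℝ) :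
    |∑ n ∈ Icc 1 ⌊x⌋₊, h n * Real.log n
        - κ * ∑ n ∈ Icc 1 ⌊x⌋₊, h n * Real.log (x / n)|
      ≤ (A + primePowConst C β) * summatory h ⌊x⌋₊ := by
  set N := ⌊x⌋₊ with hN
  have hK : 0 ≤ tailConst C β 2 + C * tailConst C β 1 := by
    have hC := zero_le_one.trans hh.one_le_const
    have := tailConst_nonneg (β := β) hC 1
    have := tailConst_nonneg (β := β) hC 2
    positivity
  set Q := ∑ p ∈ (Icc 1 N).filter Nat.Prime,
    Real.log p * (h p * summatory h (N / p)) with hQ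
  have h1 : |∑ n ∈ Icc 1 N, h n * Real.log n - Q| ≤ primePowConst C β * summatory h N := by
    rw [sum_log_mul_eq_sum_prime, hQ, ← sum_sub_distrib]
    refine (abs_sum_le_sum_abs _ _).trans ?_
    have : ∀ p ∈ (Icc 1 N).filter Nat.Prime,
        |Real.log p * ∑ n ∈ Icc 1 N, h n * n.factorization p
          - Real.log p * (h p * summatory h (N / p))|
        ≤ summatory h N * (tailConst C β 2 + C * tailConst C β 1) *
          (Real.log p * ((p : ℝ) ^ (-β)) ^ 2) := by
      intro p hp
      rw [← mul_sub, abs_mul, abs_of_nonneg (Real.log_natCast_nonneg p)]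
      calc _ ≤ Real.log p * _ := mul_le_mul_of_nonneg_left
            (hh.abs_sum_mul_factorization_sub_le (by linarith) (mem_filter.1 hp).2 N)
            (Real.log_natCast_nonneg p)
        _ = _ := by ring
    refine (sum_le_sum this).trans ?_
    rw [← mul_sum]
    have hs := (summable_log_mul_rpow_neg_sq hβ).sum_le_tsum ((Icc 1 N).filter Nat.Prime)
      fun n _ => mul_nonneg (Real.log_natCast_nonneg n) (by positivity)
    refine (mul_le_mul_of_nonneg_left hs (mul_nonneg (hh.summatory_nonneg N) hK)).trans_eq ?_
    rw [primePowConst]; ring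
  have hQ2 : Q = ∑ m ∈ Icc 1 N, h m *
      ∑ p ∈ (Icc 1 ⌊x / m⌋₊).filter Nat.Prime, h p * Real.log p := by
    simp_rw [hQ, summatory, mul_sum]
    refine (sum_comm' (s' := fun m => (Icc 1 ⌊x / (m : ℝ)⌋₊).filter Nat.Prime)
      (t' := Icc 1 N) ?_).trans (sum_congr rfl fun m _ => sum_congr rfl fun p _ => by ring)
    intro p m
    simp only [mem_filter, mem_Icc, Nat.floor_div_natCast, ← hN]
    constructor
    · rintro ⟨⟨⟨hp1, hpN⟩, hp⟩, hm1, hm⟩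
      rw [Nat.le_div_iff_mul_le (by lia)] at hm
      refine ⟨⟨⟨hp1, (Nat.le_div_iff_mul_le (by lia)).2 (by lia)⟩, hp⟩, hm1, by nlinarith⟩
    · rintro ⟨⟨⟨hp1, hpm⟩, hp⟩, hm1, hm⟩
      rw [Nat.le_div_iff_mul_le (by lia)] at hpm
      refine ⟨⟨⟨hp1, by nlinarith⟩, hp⟩, hm1, (Nat.le_div_iff_mul_le (by lia)).2 (by lia)⟩
  have h2 : |Q - κ * ∑ n ∈ Icc 1 N, h n * Real.log (x / n)| ≤ A * summatory h N := by
    rw [hQ2, mul_sum, ← sum_sub_distrib, summatory, mul_sum]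
    refine (abs_sum_le_sum_abs _ _).trans (sum_le_sum fun m hm => ?_)
    rw [mem_Icc] at hm
    have hm0 : (0 : ℝ) < m := by exact_mod_cast hm.1
    have hmx : (m : ℝ) ≤ x := (Nat.le_floor_iff' (by lia)).1 hm.2
    have := hA (x / m) ((one_le_div hm0).2 hmx)
    rw [show ∀ a b : ℝ, h m * a - κ * (h m * b) = h m * (a - κ * b) from fun a b => by ring,
      abs_mul, abs_of_nonneg (hh.nonneg m), mul_comm A]
    exact mul_le_mul_of_nonneg_left this (hh.nonneg m)
  calc _ ≤ _ := abs_sub_le _ Q _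
    _ ≤ _ := by linarith

end IsPowBoundedMul

lemma hasDerivWithinAt_max_sub_zero (a u : ℝ) :
    HasDerivWithinAt (fun v : ℝ => max (v - a) 0) (if a ≤ u then 1 else 0) (Set.Ici u) u := by
  split_ifs with hau
  · refine ((hasDerivWithinAt_id u (Set.Ici u)).sub_const a).congr (fun v hv => ?_) ?_
    · exact max_eq_left (sub_nonneg.2 (hau.trans hv))
    · exact max_eq_left (sub_nonneg.2 hau)
  · rw [not_le] at hau
    refine HasDerivAt.hasDerivWithinAt ?_
    refine (hasDerivAt_const u (0 : ℝ)).congr_of_eventuallyEq ?_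
    filter_upwards [Iio_mem_nhds hau] with v hv
    exact max_eq_right (sub_nonpos.2 (le_of_lt hv))

lemma mem_Icc_floor_exp {u : ℝ} {n : ℕ} :
    n ∈ Icc 1 ⌊Real.exp u⌋₊ ↔ 1 ≤ n ∧ Real.log n ≤ u := by
  rw [mem_Icc]
  refine and_congr_right fun hn => ?_
  have hn0 : (0 : ℝ) < n := by exact_mod_cast hn
  rw [Nat.le_floor_iff' (by lia), Real.log_le_iff_le_exp hn0]

lemma sum_max_eq (h : ℕ → ℝ) {u U : ℝ} (huU : u ≤ U) :
    ∑ n ∈ Icc 1 ⌊Real.exp U⌋₊, h n * max (u - Real.log n) 0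
      = ∑ n ∈ Icc 1 ⌊Real.exp u⌋₊, h n * (u - Real.log n) := by
  symm
  refine (sum_congr rfl fun n hn => ?_).trans (sum_subset (fun n hn => ?_) fun n hn hn' => ?_)
  · rw [max_eq_left (sub_nonneg.2 (mem_Icc_floor_exp.1 hn).2)]
  · exact mem_Icc_floor_exp.2 ⟨(mem_Icc_floor_exp.1 hn).1, (mem_Icc_floor_exp.1 hn).2.trans huU⟩
  · rw [max_eq_right, mul_zero]
    by_contra hlt
    exact hn' (mem_Icc_floor_exp.2 ⟨(mem_Icc_floor_exp.1 hn).1, by linarith⟩)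

lemma sum_ite_eq_summatory (h : ℕ → ℝ) {u U : ℝ} (huU : u ≤ U) :
    ∑ n ∈ Icc 1 ⌊Real.exp U⌋₊, h n * (if Real.log n ≤ u then 1 else 0)
      = summatory h ⌊Real.exp u⌋₊ := by
  symm
  refine (sum_congr rfl fun n hn => ?_).trans (sum_subset (fun n hn => ?_) fun n hn hn' => ?_)
  · rw [if_pos (mem_Icc_floor_exp.1 hn).2, mul_one]
  · exact mem_Icc_floor_exp.2 ⟨(mem_Icc_floor_exp.1 hn).1, (mem_Icc_floor_exp.1 hn).2.trans huU⟩
  · rw [if_neg, mul_zero]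
    intro hle
    exact hn' (mem_Icc_floor_exp.2 ⟨(mem_Icc_floor_exp.1 hn).1, hle⟩)

/-- A function on `[u₀, ∞)` with increments controlled by `D / u` has a limit, at distance
at most `D / u`. -/
lemma exists_abs_sub_le_div {f : ℝ → ℝ} {u₀ D : ℝ} (hu₀ : 0 < u₀) (hD : 0 ≤ D)
    (hf : ∀ u v, u₀ ≤ u → u ≤ v → |f v - f u| ≤ D / u) :
    ∃ ℓ, ∀ u, u₀ ≤ u → |f u - ℓ| ≤ D / u := by
  have hpos : ∀ v : ℝ, 0 < max v u₀ := fun v => hu₀.trans_le (le_max_right _ _)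
  have hc : CauchySeq fun v : ℝ => f (max v u₀) := by
    refine cauchySeq_of_le_tendsto_0 (fun N : ℝ => D / max N u₀) (fun n m N hn hm => ?_) ?_
    · rw [Real.dist_eq]
      have hn' : max N u₀ ≤ max n u₀ := max_le_max_right _ hn
      have hm' : max N u₀ ≤ max m u₀ := max_le_max_right _ hm
      rcases le_total (max n u₀) (max m u₀) with hle | hle
      · rw [abs_sub_comm]
        exact (hf _ _ (le_max_right _ _) hle).trans
          (div_le_div_of_nonneg_left hD (hpos _) hn')
      · exact (hf _ _ (le_max_right _ _) hle).trans
          (div_le_div_of_nonneg_left hD (hpos _) hm')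
    · refine tendsto_const_nhds.div_atTop ?_
      exact tendsto_atTop_mono (fun v => le_max_left v u₀) tendsto_id
  obtain ⟨ℓ, hℓ⟩ := cauchySeq_tendsto_of_complete hc
  refine ⟨ℓ, fun u hu => ?_⟩
  rw [abs_sub_comm]
  refine le_of_tendsto ((hℓ.sub_const (f u)).abs) ?_
  filter_upwards [eventually_ge_atTop u] with v hv
  exact hf u _ hu (hv.trans (le_max_left _ _))

namespace IsPowBoundedMul

variable {h : ℕ → ℝ} {C β : ℝ}

/-- The approximate recursion for `∑ h n log n` forces an asymptotic formula for `∑ h n`. -/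
lemma exists_abs_summatory_sub_le {κ B K : ℝ} (hκ : 0 ≤ κ) (hB : 0 ≤ B) (hK : 0 ≤ K)
    (hrec : ∀ x : ℝ, |∑ n ∈ Icc 1 ⌊x⌋₊, h n * Real.log n
        - κ * ∑ n ∈ Icc 1 ⌊x⌋₊, h n * Real.log (x / n)| ≤ B * summatory h ⌊x⌋₊)
    (hM : ∀ u, Real.log 2 ≤ u → summatory h ⌊Real.exp u⌋₊ ≤ K * u ^ κ) :
    ∃ c, ∀ u, Real.log 2 ≤ u →
      |summatory h ⌊Real.exp u⌋₊ - c * u ^ κ| ≤ (κ + 2) * (B * K) * u ^ (κ - 1) := by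
  have hlog2 : 0 < Real.log 2 := Real.log_pos (by norm_num)
  set T : ℝ → ℝ := fun u => ∑ n ∈ Icc 1 ⌊Real.exp u⌋₊, h n * (u - Real.log n) with hT
  set f : ℝ → ℝ := fun u => T u * u ^ (-(κ + 1)) with hf
  have hΔ : ∀ u, Real.log 2 ≤ u →
      |u * summatory h ⌊Real.exp u⌋₊ - (κ + 1) * T u| ≤ B * K * u ^ κ := by
    intro u hu
    have h1 := hrec (Real.exp u)
    have h2 : ∑ n ∈ Icc 1 ⌊Real.exp u⌋₊, h n * Real.log (Real.exp u / n) = T u := by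
      refine sum_congr rfl fun n hn => ?_
      have : (n : ℝ) ≠ 0 := by
        have := (mem_Icc.1 hn).1
        exact_mod_cast (show n ≠ 0 by lia)
      rw [Real.log_div (Real.exp_ne_zero u) this, Real.log_exp]
    have h3 : ∑ n ∈ Icc 1 ⌊Real.exp u⌋₊, h n * Real.log n
        = u * summatory h ⌊Real.exp u⌋₊ - T u := by
      rw [summatory, hT, mul_sum, ← sum_sub_distrib]
      exact sum_congr rfl fun n _ => by ring
    rw [h2, h3] at h1
    calc _ = |u * summatory h ⌊Real.exp u⌋₊ - T u - κ * T u| := by congr 1; ring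
      _ ≤ _ := h1
      _ ≤ B * (K * u ^ κ) := mul_le_mul_of_nonneg_left (hM u hu) hB
      _ = _ := by ring
  have hinc : ∀ u v, Real.log 2 ≤ u → u ≤ v → |f v - f u| ≤ B * K / u := by
    intro u v hu huv
    have hu0 : 0 < u := hlog2.trans_le hu
    set TU : ℝ → ℝ := fun w => ∑ n ∈ Icc 1 ⌊Real.exp v⌋₊, h n * max (w - Real.log n) 0 with hTU
    have hTUeq : ∀ w ≤ v, TU w = T w := fun w hw => sum_max_eq h hw
    have hTUcont : Continuous TU := by
      refine continuous_finsetSum _ fun n _ => ?_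
      fun_prop
    have hTUder : ∀ w ≤ v, HasDerivWithinAt TU (summatory h ⌊Real.exp w⌋₊) (Set.Ici w) w := by
      intro w hw
      rw [← sum_ite_eq_summatory h hw]
      refine HasDerivWithinAt.fun_sum fun n _ => ?_
      exact (hasDerivWithinAt_max_sub_zero _ w).const_mul _
    have hmain := image_norm_le_of_norm_deriv_right_le_deriv_boundary'
      (f := fun w => TU w * w ^ (-(κ + 1)) - f u)
      (f' := fun w => w ^ (-κ - 2) * (w * summatory h ⌊Real.exp w⌋₊ - (κ + 1) * T w))
      (a := u) (b := v) (B := fun w => B * K / u - B * K / w)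
      (B' := fun w => B * K / w ^ 2) ?_ ?_ ?_ ?_ ?_ ?_ (x := v) ⟨huv, le_rfl⟩
    · simp only [Real.norm_eq_abs, hTUeq v le_rfl] at hmain
      refine hmain.trans ?_
      have : 0 ≤ B * K / v := by have := hu0.trans_le huv; positivity
      linarith
    · refine ((hTUcont.continuousOn).mul fun w hw => ?_).sub continuousOn_const
      exact (Real.continuousAt_rpow_const _ _
        (Or.inl (hu0.trans_le hw.1).ne')).continuousWithinAt
    · intro w hw
      have hw0 : 0 < w := hu0.trans_le hw.1
      have := ((hTUder w hw.2.le).mul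
        (Real.hasDerivAt_rpow_const (p := -(κ + 1)) (Or.inl hw0.ne')).hasDerivWithinAt).sub_const
          (f u)
      refine this.congr_deriv ?_
      rw [hTUeq w hw.2.le, show -(κ + 1) = (-κ - 2) + 1 by ring, Real.rpow_add_one hw0.ne',
        show -κ - 2 + 1 - 1 = -κ - 2 by ring]
      ring
    · simp [hTUeq u huv, hf]
    · intro w hw
      have hw0 : w ≠ 0 := (hu0.trans_le hw.1).ne'
      exact (continuousAt_const.sub (continuousAt_const.div continuousAt_id hw0)).continuousWithinAt
    · intro w hw
      have hw0 : w ≠ 0 := (hu0.trans_le hw.1).ne'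
      have := (((hasDerivAt_inv hw0).const_mul (B * K)).const_sub (B * K / u)).hasDerivWithinAt
        (s := Set.Ici w)
      refine (this.congr_deriv ?_)
      field_simp
    · intro w hw
      have hw0 : 0 < w := hu0.trans_le hw.1
      rw [Real.norm_eq_abs, abs_mul, abs_of_pos (Real.rpow_pos_of_pos hw0 _)]
      calc _ ≤ w ^ (-κ - 2) * (B * K * w ^ κ) := by
            gcongr; exact hΔ w (hu.trans hw.1)
        _ = B * K * (w ^ (-κ - 2) * w ^ κ) := by ring
        _ = _ := by
          rw [← Real.rpow_add hw0, show -κ - 2 + κ = -(2 : ℝ) by ring, Real.rpow_neg hw0.le,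
            Real.rpow_two, div_eq_mul_inv]
  obtain ⟨ℓ, hℓ⟩ := exists_abs_sub_le_div hlog2 (mul_nonneg hB hK) hinc
  refine ⟨(κ + 1) * ℓ, fun u hu => ?_⟩
  have hu0 : 0 < u := hlog2.trans_le hu
  have hTf : T u = f u * (u ^ κ * u) := by
    rw [hf]
    simp only
    rw [mul_assoc, ← Real.rpow_add_one hu0.ne', ← Real.rpow_add hu0]
    simp
  have e : summatory h ⌊Real.exp u⌋₊ - (κ + 1) * ℓ * u ^ κ
      = (u * summatory h ⌊Real.exp u⌋₊ - (κ + 1) * T u) / u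
        + (κ + 1) * u ^ κ * (f u - ℓ) := by
    rw [hTf]; field_simp; ring
  rw [e]
  refine (abs_add_le _ _).trans ?_
  rw [abs_div, abs_of_pos hu0, abs_mul, abs_of_nonneg (by positivity : 0 ≤ (κ + 1) * u ^ κ)]
  calc _ ≤ B * K * u ^ κ / u + (κ + 1) * u ^ κ * (B * K / u) := by
        gcongr
        · exact hΔ u hu
        · exact hℓ u hu
    _ = _ := by rw [Real.rpow_sub_one hu0.ne']; ring

end IsPowBoundedMul

/-- The coefficients `h n * n ^ (-s)` of a Dirichlet series. -/
noncomputable def twist (h : ℕ → ℝ) (s : ℝ) (n : ℕ) : ℝ := h n * (n : ℝ) ^ (-s)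

namespace IsPowBoundedMul

open MeasureTheory

variable {h : ℕ → ℝ} {C β : ℝ}

lemma twist_nonneg (hh : IsPowBoundedMul h C β) (s : ℝ) (n : ℕ) : 0 ≤ twist h s n :=
  mul_nonneg (hh.nonneg n) (by positivity)

/-- A Dirichlet series as a Laplace transform of the summatory function. -/
lemma tsum_twist_eq_integral (hh : IsPowBoundedMul h C β) {s : ℝ} (hs : 0 < s)
    (hsum : Summable (twist h s)) :
    ∑' n, twist h s n
      = ∫ v in Set.Ioi (0 : ℝ), summatory h ⌊Real.exp (v / s)⌋₊ * Real.exp (-v) := by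
  set F : ℕ → ℝ → ℝ := fun n => (Set.Ici (s * Real.log n)).indicator
    fun v => h n * Real.exp (-v) with hF
  have ha : ∀ n : ℕ, 0 ≤ s * Real.log n := fun n =>
    mul_nonneg hs.le (Real.log_natCast_nonneg n)
  have hint : ∀ n, IntegrableOn (fun v => h n * Real.exp (-v)) (Set.Ici (s * Real.log n)) := by
    intro n
    rw [integrableOn_Ici_iff_integrableOn_Ioi]
    exact (integrableOn_exp_neg_Ioi _).const_mul _
  have hF_int : ∀ n, Integrable (F n) (volume.restrict (Set.Ici 0)) := fun n =>
    ((integrable_indicator_iff measurableSet_Ici).2 (hint n)).restrict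
  have hval : ∀ n, ∫ v in Set.Ici (0 : ℝ), F n v = twist h s n := by
    intro n
    rw [hF, setIntegral_indicator measurableSet_Ici,
      Set.inter_eq_self_of_subset_right (Set.Ici_subset_Ici.2 (ha n)),
      integral_Ici_eq_integral_Ioi, integral_const_mul, integral_exp_neg_Ioi, twist]
    rcases Nat.eq_zero_or_pos n with rfl | hn
    · simp [hh.zero]
    · rw [Real.rpow_def_of_pos (by exact_mod_cast hn)]
      congr 2; ring
  have hnonneg : ∀ n v, 0 ≤ F n v := fun n v =>
    Set.indicator_nonneg (fun _ _ => mul_nonneg (hh.nonneg n) (Real.exp_nonneg _)) v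
  have hF_sum : Summable fun n => ∫ v in Set.Ici (0 : ℝ), ‖F n v‖ := by
    simp_rw [Real.norm_of_nonneg (hnonneg _ _), hval]
    exact hsum
  have hmain := (hasSum_integral_of_summable_integral_norm hF_int hF_sum).tsum_eq
  simp_rw [hval] at hmain
  rw [hmain, ← integral_Ici_eq_integral_Ioi]
  refine setIntegral_congr_fun measurableSet_Ici fun v _ => ?_
  rw [summatory, sum_mul, tsum_eq_sum (s := Icc 1 ⌊Real.exp (v / s)⌋₊)]
  · refine sum_congr rfl fun n hn => ?_
    have := (mem_Icc_floor_exp.1 hn).2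
    rw [le_div_iff₀ hs, mul_comm] at this
    simp only [hF]
    rw [Set.indicator_of_mem (Set.mem_Ici.2 this)]
  · intro n hn
    rcases Nat.eq_zero_or_pos n with rfl | hn0
    · simp [hF, hh.zero]
    · refine Set.indicator_of_notMem (fun hv => hn ?_) _
      rw [Set.mem_Ici] at hv
      exact mem_Icc_floor_exp.2 ⟨hn0, by rw [le_div_iff₀ hs]; linarith⟩

/-- The Abelian theorem for Dirichlet series at `s = 0`. -/
lemma tendsto_rpow_mul_tsum_twist (hh : IsPowBoundedMul h C β) {κ K c : ℝ} (hκ : 0 ≤ κ)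
    (hsum : ∀ s, 0 < s → Summable (twist h s))
    (hM : ∀ u, Real.log 2 ≤ u → summatory h ⌊Real.exp u⌋₊ ≤ K * u ^ κ)
    (hlim : Tendsto (fun u => summatory h ⌊Real.exp u⌋₊ / u ^ κ) atTop (nhds c)) :
    Tendsto (fun s => s ^ κ * ∑' n, twist h s n) (nhdsWithin 0 (Set.Ioi 0))
      (nhds (Real.Gamma (κ + 1) * c)) := by
  have hK : 0 ≤ K := by
    have h2 : 0 < Real.log 2 := Real.log_pos (by norm_num)
    have h1 := (hh.summatory_nonneg _).trans (hM _ le_rfl)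
    exact nonneg_of_mul_nonneg_left h1 (Real.rpow_pos_of_pos h2 κ)
  have hGint : IntegrableOn (fun x : ℝ => Real.exp (-x) * x ^ κ) (Set.Ioi 0) := by
    simpa using Real.GammaIntegral_convergent (s := κ + 1) (by linarith)
  have hG : Real.Gamma (κ + 1) * c
      = ∫ v in Set.Ioi (0 : ℝ), c * (Real.exp (-v) * v ^ κ) := by
    rw [Real.Gamma_eq_integral (by linarith), integral_const_mul, mul_comm]
    simp
  have hcongr : (fun s => s ^ κ * ∑' n, twist h s n) =ᶠ[nhdsWithin 0 (Set.Ioi 0)]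
      fun s => ∫ v in Set.Ioi (0 : ℝ),
        s ^ κ * (summatory h ⌊Real.exp (v / s)⌋₊ * Real.exp (-v)) := by
    filter_upwards [self_mem_nhdsWithin] with s hs
    rw [hh.tsum_twist_eq_integral hs (hsum s hs), integral_const_mul]
  rw [hG]
  refine Tendsto.congr' hcongr.symm ?_
  refine tendsto_integral_filter_of_dominated_convergence
    (fun v => Real.exp (-v) + K * (Real.exp (-v) * v ^ κ)) ?_ ?_ ?_ ?_
  · refine Eventually.of_forall fun s => Measurable.aestronglyMeasurable ?_
    have h1 : Measurable fun v : ℝ => summatory h ⌊Real.exp (v / s)⌋₊ :=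
      (measurable_from_top (f := summatory h)).comp
        (Nat.measurable_floor.comp (by fun_prop))
    exact (h1.mul (by fun_prop)).const_mul _
  · have hmem : Set.Ioc (0 : ℝ) 1 ∈ nhdsWithin (0 : ℝ) (Set.Ioi 0) :=
      Ioc_mem_nhdsGT one_pos
    filter_upwards [hmem] with s hs
    refine (ae_restrict_iff' measurableSet_Ioi).2 (Eventually.of_forall fun v hv => ?_)
    have hv0 : 0 < v := hv
    have hs0 : 0 < s := hs.1
    rw [Real.norm_of_nonneg (mul_nonneg (by positivity)
      (mul_nonneg (hh.summatory_nonneg _) (by positivity)))]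
    rcases le_or_gt (Real.log 2) (v / s) with hvs | hvs
    · have h1 : s ^ κ * summatory h ⌊Real.exp (v / s)⌋₊ ≤ K * v ^ κ := by
        calc _ ≤ s ^ κ * (K * (v / s) ^ κ) := by gcongr; exact hM _ hvs
          _ = K * (s ^ κ * (v / s) ^ κ) := by ring
          _ = _ := by
            rw [← Real.mul_rpow hs0.le (by positivity), mul_div_cancel₀ _ hs0.ne']
      have := mul_le_mul_of_nonneg_right h1 (Real.exp_nonneg (-v))
      have := Real.exp_nonneg (-v)
      linarith
    · have h2 : ⌊Real.exp (v / s)⌋₊ ≤ 1 := by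
        have : Real.exp (v / s) < 2 := by
          rwa [← Real.lt_log_iff_exp_lt (by norm_num)]
        have : ⌊Real.exp (v / s)⌋₊ < 2 := (Nat.floor_lt (Real.exp_nonneg _)).2 (by simpa using this)
        lia
      have h3 : summatory h ⌊Real.exp (v / s)⌋₊ ≤ 1 :=
        (hh.summatory_mono h2).trans_eq (by simp [summatory, hh.one])
      have h4 : s ^ κ ≤ 1 := Real.rpow_le_one hs0.le hs.2 hκ
      have h5 : s ^ κ * summatory h ⌊Real.exp (v / s)⌋₊ ≤ 1 :=
        mul_le_one₀ h4 (hh.summatory_nonneg _) h3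
      have := mul_le_mul_of_nonneg_right h5 (Real.exp_nonneg (-v))
      have : 0 ≤ K * (Real.exp (-v) * v ^ κ) := by positivity
      linarith
  · exact (integrableOn_exp_neg_Ioi 0).add (hGint.const_mul K)
  · refine (ae_restrict_iff' measurableSet_Ioi).2 (Eventually.of_forall fun v hv => ?_)
    have hv0 : 0 < v := hv
    have h1 : Tendsto (fun s : ℝ => v / s) (nhdsWithin 0 (Set.Ioi 0)) atTop := by
      simp_rw [div_eq_mul_inv]
      exact tendsto_inv_nhdsGT_zero.const_mul_atTop hv0
    refine (((hlim.comp h1).mul_const (Real.exp (-v) * v ^ κ))).congr' ?_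
    filter_upwards [self_mem_nhdsWithin] with s hs
    have hs0 : 0 < s := hs
    simp only [Function.comp]
    rw [Real.div_rpow hv0.le hs0.le]
    have := Real.rpow_pos_of_pos hs0 κ
    have := Real.rpow_pos_of_pos hv0 κ
    field_simp

end IsPowBoundedMul

lemma log_factorial_eq_sum_prime (N : ℕ) :
    Real.log N.factorial
      = ∑ p ∈ (Icc 1 N).filter Nat.Prime, N.factorial.factorization p * Real.log p := by
  rw [Real.log_nat_eq_sum_factorization, Finsupp.sum]
  refine sum_subset (fun p hp => ?_) fun p _ hp => ?_
  · rw [Nat.support_factorization, Nat.mem_primeFactors] at hp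
    simp only [mem_filter, mem_Icc]
    exact ⟨⟨hp.1.one_le, (hp.1.dvd_factorial).1 hp.2.1⟩, hp.1⟩
  · rw [Finsupp.notMem_support_iff] at hp
    simp [hp]

lemma div_sub_one_le_factorization_factorial {p : ℕ} (hp : p.Prime) (N : ℕ) :
    (N : ℝ) / p - 1 ≤ N.factorial.factorization p := by
  have h1 : N / p ≤ N.factorial.factorization p := by
    rw [Nat.factorization_factorial hp (b := Nat.log p N + 2) (by lia)]
    calc N / p = N / p ^ 1 := by rw [pow_one]
      _ ≤ _ := single_le_sum (f := fun i => N / p ^ i) (fun _ _ => Nat.zero_le _)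
        (mem_Ico.2 ⟨le_rfl, by lia⟩)
  have h2 : (N : ℝ) / p < (N / p : ℕ) + 1 := by
    rw [← Nat.floor_div_eq_div (K := ℝ)]
    exact Nat.lt_floor_add_one _
  have h3 : ((N / p : ℕ) : ℝ) ≤ N.factorial.factorization p := by exact_mod_cast h1
  linarith

lemma factorization_factorial_le_div_add {p : ℕ} (hp : p.Prime) (N : ℕ) :
    (N.factorial.factorization p : ℝ) ≤ N / p + N * (2 * ((p : ℝ) ^ (-1 : ℝ)) ^ 2) := by
  have h1 := Nat.factorization_factorial_le_div_pred hp N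
  have h2 : (2 : ℝ) ≤ p := by exact_mod_cast hp.two_le
  have h3 : ((N / (p - 1) : ℕ) : ℝ) ≤ N / ((p : ℝ) - 1) := by
    refine Nat.cast_div_le.trans_eq ?_
    rw [Nat.cast_sub hp.one_le, Nat.cast_one]
  have h4 : (N.factorial.factorization p : ℝ) ≤ N / ((p : ℝ) - 1) :=
    le_trans (by exact_mod_cast h1) h3
  refine h4.trans ?_
  rw [Real.rpow_neg_one, div_eq_mul_inv, div_eq_mul_inv, ← mul_add]
  refine mul_le_mul_of_nonneg_left ?_ (Nat.cast_nonneg N)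
  have hp0 : (0 : ℝ) < p := by linarith
  have hp1 : (0 : ℝ) < p - 1 := by linarith
  rw [← sub_nonneg]
  have : (p : ℝ)⁻¹ + 2 * (p : ℝ)⁻¹ ^ 2 - ((p : ℝ) - 1)⁻¹
      = (p - 2) / (p ^ 2 * (p - 1)) := by field_simp; ring
  rw [this]
  exact div_nonneg (by linarith) (by positivity)

/-- Mertens' first theorem. -/
theorem exists_abs_sum_log_div_prime_sub_log_le :
    ∃ A : ℝ, ∀ N : ℕ, 1 ≤ N →
      |∑ p ∈ (Icc 1 N).filter Nat.Prime, Real.log p / p - Real.log N| ≤ A := by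
  set S := ∑' n : ℕ, Real.log n * ((n : ℝ) ^ (-1 : ℝ)) ^ 2 with hS
  have hsum : Summable fun n : ℕ => Real.log n * ((n : ℝ) ^ (-1 : ℝ)) ^ 2 :=
    summable_log_mul_rpow_neg_sq (by norm_num)
  have hS0 : 0 ≤ S := tsum_nonneg fun n => mul_nonneg (Real.log_natCast_nonneg n) (by positivity)
  refine ⟨Real.log 4 + 1 + 2 * S, fun N hN => ?_⟩
  have hN0 : (0 : ℝ) < N := by exact_mod_cast hN
  set M := ∑ p ∈ (Icc 1 N).filter Nat.Prime, Real.log p / p with hM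
  have hlow : N * M - Real.log 4 * N ≤ Real.log N.factorial := by
    have hθ : ∑ p ∈ (Icc 1 N).filter Nat.Prime, Real.log p ≤ Real.log 4 * N := by
      refine le_trans ?_ (Chebyshev.theta_le_log4_mul_x hN0.le)
      rw [Chebyshev.theta_eq_sum_Icc, Nat.floor_natCast]
      exact sum_le_sum_of_subset_of_nonneg
        (filter_subset_filter _ (Icc_subset_Icc_left (Nat.zero_le 1)))
        fun n _ _ => Real.log_natCast_nonneg n
    have : N * M - ∑ p ∈ (Icc 1 N).filter Nat.Prime, Real.log p ≤ Real.log N.factorial := by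
      rw [log_factorial_eq_sum_prime, hM, mul_sum, ← sum_sub_distrib]
      refine sum_le_sum fun p hp => ?_
      have := mul_le_mul_of_nonneg_right
        (div_sub_one_le_factorization_factorial (mem_filter.1 hp).2 N)
        (Real.log_natCast_nonneg p)
      calc _ = ((N : ℝ) / p - 1) * Real.log p := by ring
        _ ≤ _ := this
    linarith
  have hup : Real.log N.factorial ≤ N * M + N * (2 * S) := by
    have : Real.log N.factorial ≤ N * M + ∑ p ∈ (Icc 1 N).filter Nat.Prime,
        N * 2 * (Real.log p * ((p : ℝ) ^ (-1 : ℝ)) ^ 2) := by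
      rw [log_factorial_eq_sum_prime, hM, mul_sum, ← sum_add_distrib]
      refine sum_le_sum fun p hp => ?_
      have := mul_le_mul_of_nonneg_right
        (factorization_factorial_le_div_add (mem_filter.1 hp).2 N)
        (Real.log_natCast_nonneg p)
      calc _ ≤ _ := this
        _ = _ := by ring
    rw [← mul_sum] at this
    have h2 := hsum.sum_le_tsum ((Icc 1 N).filter Nat.Prime)
      fun n _ => mul_nonneg (Real.log_natCast_nonneg n) (by positivity)
    have h3 := mul_le_mul_of_nonneg_left h2 (show (0 : ℝ) ≤ N * 2 by positivity)
    rw [← hS] at h3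
    linarith
  have hf0 : (0 : ℝ) < N.factorial := by exact_mod_cast N.factorial_pos
  have hfup : Real.log N.factorial ≤ N * Real.log N := by
    rw [← Real.log_pow]
    exact Real.log_le_log hf0 (by exact_mod_cast N.factorial_le_pow)
  have hflow : N * Real.log N - N ≤ Real.log N.factorial := by
    have h1 := Real.pow_div_factorial_le_exp N hN0.le N
    have h2 := Real.log_le_log (by positivity) h1
    rw [Real.log_exp, Real.log_div (by positivity) hf0.ne', Real.log_pow] at h2
    linarith
  have h4 : 0 ≤ Real.log 4 := Real.log_nonneg (by norm_num)
  have k1 : N * (M - Real.log N) ≤ N * Real.log 4 := by linarith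
  have k2 : N * (Real.log N - M) ≤ N * (1 + 2 * S) := by linarith
  rw [abs_le]
  constructor
  · have := le_of_mul_le_mul_left k2 hN0
    linarith
  · have := le_of_mul_le_mul_left k1 hN0
    linarith

/-- The Euler factor at `p` of the Dirichlet series with coefficients `h n * n ^ (-s)`. -/
noncomputable def eulerFactor (h : ℕ → ℝ) (s : ℝ) (p : ℕ) : ℝ := ∑' r : ℕ, twist h s (p ^ r)

/-- The logarithm of the Euler factor at `p` normalised by `(1 - p ^ (-1 - s)) ^ κ`. -/
noncomputable def logFactor (h : ℕ → ℝ) (κ s : ℝ) (p : ℕ) : ℝ :=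
  κ * Real.log (1 - (p : ℝ)⁻¹ * (p : ℝ) ^ (-s)) + Real.log (eulerFactor h s p)

/-- The logarithm of the normalised partial Euler product. -/
noncomputable def logProd (h : ℕ → ℝ) (κ s : ℝ) (N : ℕ) : ℝ :=
  ∑ p ∈ N.primesBelow, logFactor h κ s p

/-- The error made in replacing a logarithmic factor by its linear term. -/
noncomputable def logFactorError (C β κ : ℝ) (n : ℕ) : ℝ :=
  (tailConst C β 2 + tailConst C β 1 ^ 2) * ((n : ℝ) ^ (-β)) ^ 2
    + 2 * κ * ((n : ℝ) ^ (-1 : ℝ)) ^ 2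

lemma summable_rpow_neg_sq {β : ℝ} (hβ : 1 / 2 < β) :
    Summable fun n : ℕ => ((n : ℝ) ^ (-β)) ^ 2 := by
  refine (Real.summable_nat_rpow.2 (show -β * 2 < -1 by linarith)).congr fun n => ?_
  rw [Real.rpow_mul (Nat.cast_nonneg n), Real.rpow_two]

lemma summable_logFactorError {C β κ : ℝ} (hβ : 1 / 2 < β) :
    Summable (logFactorError C β κ) :=
  ((summable_rpow_neg_sq hβ).mul_left _).add
    ((summable_rpow_neg_sq (by norm_num)).mul_left _)

lemma logFactorError_nonneg {C β κ : ℝ} (hC : 0 ≤ C) (hκ : 0 ≤ κ) (n : ℕ) :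
    0 ≤ logFactorError C β κ n := by
  have := tailConst_nonneg (β := β) hC 2
  unfold logFactorError
  positivity

lemma abs_log_one_sub_add_le {z : ℝ} (hz0 : 0 ≤ z) (hz : z ≤ 1 / 2) :
    |Real.log (1 - z) + z| ≤ 2 * z ^ 2 := by
  have h1 := Real.abs_log_sub_add_sum_range_le (x := z) (by rw [abs_of_nonneg hz0]; linarith) 1
  simp only [range_one, sum_singleton, zero_add, pow_one, Nat.cast_zero, div_one,
    abs_of_nonneg hz0] at h1
  rw [add_comm]
  refine h1.trans ?_
  rw [div_le_iff₀ (by linarith)]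
  norm_num
  nlinarith [sq_nonneg z]

/-- Abel's inequality for a nonnegative antitone weight. -/
lemma abs_sum_Ico_mul_le {b w : ℕ → ℝ} {A : ℝ} (hb : ∀ n, |∑ i ∈ range n, b i| ≤ A)
    {N : ℕ} (hw0 : ∀ n, N ≤ n → 0 ≤ w n) (hw : ∀ n, N ≤ n → w (n + 1) ≤ w n) {M : ℕ}
    (hNM : N ≤ M) : |∑ i ∈ Ico N M, b i * w i| ≤ 2 * A * w N := by
  have key : |∑ i ∈ Ico N M, b i * w i
      - w M * ∑ i ∈ range M, b i + w N * ∑ i ∈ range N, b i| ≤ A * (w N - w M) := by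
    induction M, hNM using Nat.le_induction with
    | base => simp
    | succ m hm ih =>
      have e : ∑ i ∈ Ico N (m + 1), b i * w i - w (m + 1) * ∑ i ∈ range (m + 1), b i
            + w N * ∑ i ∈ range N, b i
          = (∑ i ∈ Ico N m, b i * w i - w m * ∑ i ∈ range m, b i + w N * ∑ i ∈ range N, b i)
            + (w m - w (m + 1)) * ∑ i ∈ range (m + 1), b i := by
        rw [sum_Ico_succ_top hm, sum_range_succ]; ring
      rw [e]
      refine (abs_add_le _ _).trans ?_
      rw [abs_mul, abs_of_nonneg (sub_nonneg.2 (hw m hm))]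
      have := mul_le_mul_of_nonneg_left (hb (m + 1)) (sub_nonneg.2 (hw m hm))
      linarith
  have h1 : |w M * ∑ i ∈ range M, b i| ≤ w M * A := by
    rw [abs_mul, abs_of_nonneg (hw0 M hNM)]
    exact mul_le_mul_of_nonneg_left (hb M) (hw0 M hNM)
  have h2 : |w N * ∑ i ∈ range N, b i| ≤ w N * A := by
    rw [abs_mul, abs_of_nonneg (hw0 N le_rfl)]
    exact mul_le_mul_of_nonneg_left (hb N) (hw0 N le_rfl)
  rw [abs_le] at *
  constructor <;> linarith

namespace IsPowBoundedMul

variable {h : ℕ → ℝ} {C β : ℝ}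

lemma twist (hh : IsPowBoundedMul h C β) {s : ℝ} (hs : 0 ≤ s) :
    IsPowBoundedMul (twist h s) C β where
  zero := by simp [_root_.twist, hh.zero]
  one := by simp [_root_.twist, hh.one]
  mul {m n} hmn := by
    simp only [_root_.twist]
    rw [hh.mul hmn, Nat.cast_mul, Real.mul_rpow (Nat.cast_nonneg _) (Nat.cast_nonneg _)]
    ring
  nonneg := hh.twist_nonneg s
  pow_le p hp k := by
    refine le_trans ?_ (hh.pow_le p hp k)
    refine mul_le_of_le_one_right (hh.nonneg _) ?_
    refine Real.rpow_le_one_of_one_le_of_nonpos ?_ (by linarith)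
    exact_mod_cast Nat.one_le_pow _ _ hp.pos

lemma summable_pow (hh : IsPowBoundedMul h C β) (hβ : 0 < β) {p : ℕ} (hp : p.Prime) :
    Summable fun k => h (p ^ k) := by
  have ht0 : 0 ≤ (p : ℝ) ^ (-β) := by positivity
  have ht1 := (rpow_neg_prime_le hβ hp).trans_lt (two_rpow_neg_lt_one hβ)
  exact Summable.of_nonneg_of_le (fun k => hh.nonneg _) (hh.pow_le p hp)
    ((summable_geometric_of_lt_one ht0 ht1).mul_left C)

lemma one_le_tsum_pow (hh : IsPowBoundedMul h C β) (hβ : 0 < β) {p : ℕ} (hp : p.Prime) :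
    1 ≤ ∑' k, h (p ^ k) := by
  have := (hh.summable_pow hβ hp).le_tsum 0 fun k _ => hh.nonneg _
  simpa [hh.one] using this

lemma tsum_pow_sub_one_le (hh : IsPowBoundedMul h C β) (hβ : 0 < β) {p : ℕ} (hp : p.Prime) :
    ∑' k, h (p ^ k) - 1 ≤ tailConst C β 1 * (p : ℝ) ^ (-β) := by
  set φ : ℕ → ℝ := fun k => if 1 ≤ k then 1 else 0 with hφ
  have h0 : ∀ k, 0 ≤ φ k := fun k => by simp only [hφ]; split_ifs <;> simp
  have hk : ∀ k, φ k ≤ k := fun k => by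
    simp only [hφ]; split_ifs with hk
    · exact_mod_cast hk
    · simp
  have h1 := hh.tsum_mul_pow_le hβ hp (j := 1) h0 hk
    (fun k hk => by simp only [hφ]; rw [if_neg (by lia)])
  rw [(hh.summable_mul_pow hβ hp h0 hk).tsum_eq_zero_add] at h1
  rw [(hh.summable_pow hβ hp).tsum_eq_zero_add]
  simpa [hφ, hh.one] using h1

lemma tsum_pow_sub_one_sub_le (hh : IsPowBoundedMul h C β) (hβ : 0 < β) {p : ℕ}
    (hp : p.Prime) :
    ∑' k, h (p ^ k) - 1 - h p ≤ tailConst C β 2 * ((p : ℝ) ^ (-β)) ^ 2 := by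
  set φ : ℕ → ℝ := fun k => if 2 ≤ k then 1 else 0 with hφ
  have h0 : ∀ k, 0 ≤ φ k := fun k => by simp only [hφ]; split_ifs <;> simp
  have hk : ∀ k, φ k ≤ k := fun k => by
    simp only [hφ]; split_ifs with hk
    · exact_mod_cast (show 1 ≤ k by lia)
    · simp
  have h1 := hh.tsum_mul_pow_le hβ hp (j := 2) h0 hk
    (fun k hk => by simp only [hφ]; rw [if_neg (by lia)])
  rw [← (hh.summable_mul_pow hβ hp h0 hk).sum_add_tsum_nat_add 2] at h1
  rw [← (hh.summable_pow hβ hp).sum_add_tsum_nat_add 2]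
  simp only [sum_range_succ, range_zero, sum_empty, hφ] at h1 ⊢
  simp [hh.one] at h1 ⊢
  linarith

lemma abs_log_tsum_pow_sub_le (hh : IsPowBoundedMul h C β) (hβ : 0 < β) {p : ℕ}
    (hp : p.Prime) :
    |Real.log (∑' k, h (p ^ k)) - h p|
      ≤ (tailConst C β 2 + tailConst C β 1 ^ 2) * ((p : ℝ) ^ (-β)) ^ 2 := by
  have h1 := hh.one_le_tsum_pow hβ hp
  have h2 := hh.tsum_pow_sub_one_le hβ hp
  have h3 := hh.tsum_pow_sub_one_sub_le hβ hp
  have h4 : h p + 1 ≤ ∑' k, h (p ^ k) := by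
    have := (hh.summable_pow hβ hp).sum_le_tsum (range 2) fun k _ => hh.nonneg _
    simp only [sum_range_succ, range_zero, sum_empty, pow_zero, hh.one, pow_one] at this
    linarith
  set F := ∑' k, h (p ^ k)
  set t := (p : ℝ) ^ (-β)
  have ht : 0 ≤ tailConst C β 1 := tailConst_nonneg (zero_le_one.trans hh.one_le_const) _
  have hu := Real.log_le_sub_one_of_pos (show 0 < F by linarith)
  have hl := Real.one_sub_inv_le_log_of_pos (show 0 < F by linarith)
  have hl2 : F - 1 - (F - 1) ^ 2 ≤ 1 - F⁻¹ := by
    have hF : 0 < F := by linarith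
    rw [← sub_nonneg]
    have : 1 - F⁻¹ - (F - 1 - (F - 1) ^ 2) = (F - 1) ^ 3 / F := by field_simp; ring
    rw [this]
    exact div_nonneg (pow_nonneg (by linarith) 3) hF.le
  have hsq : (F - 1) ^ 2 ≤ (tailConst C β 1 * t) ^ 2 :=
    pow_le_pow_left₀ (by linarith) h2 2
  have h5 : 0 ≤ tailConst C β 2 * t ^ 2 :=
    mul_nonneg (tailConst_nonneg (zero_le_one.trans hh.one_le_const) _) (sq_nonneg t)
  have h6 : 0 ≤ (tailConst C β 1 * t) ^ 2 := sq_nonneg _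
  rw [mul_pow] at hsq h6
  rw [abs_le]
  constructor <;> linarith

lemma one_le_eulerFactor (hh : IsPowBoundedMul h C β) (hβ : 0 < β) {s : ℝ} (hs : 0 ≤ s)
    {p : ℕ} (hp : p.Prime) : 1 ≤ eulerFactor h s p :=
  (hh.twist hs).one_le_tsum_pow hβ hp

end IsPowBoundedMul

lemma inv_mul_rpow_neg_mem {s : ℝ} (hs : 0 ≤ s) {p : ℕ} (hp : p.Prime) :
    0 ≤ (p : ℝ)⁻¹ * (p : ℝ) ^ (-s) ∧ (p : ℝ)⁻¹ * (p : ℝ) ^ (-s) ≤ (p : ℝ)⁻¹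
      ∧ (p : ℝ)⁻¹ * (p : ℝ) ^ (-s) ≤ 1 / 2 := by
  have hp2 : (2 : ℝ) ≤ p := by exact_mod_cast hp.two_le
  have h1 : (p : ℝ) ^ (-s) ≤ 1 :=
    Real.rpow_le_one_of_one_le_of_nonpos (by linarith) (by linarith)
  have h2 : (p : ℝ)⁻¹ * (p : ℝ) ^ (-s) ≤ (p : ℝ)⁻¹ := mul_le_of_le_one_right (by positivity) h1
  refine ⟨by positivity, h2, h2.trans ?_⟩
  rw [one_div]
  exact inv_anti₀ (by norm_num) hp2

namespace IsPowBoundedMul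

variable {h : ℕ → ℝ} {C β : ℝ}

lemma abs_logFactor_sub_le (hh : IsPowBoundedMul h C β) (hβ : 0 < β) {κ : ℝ} (hκ : 0 ≤ κ)
    {s : ℝ} (hs : 0 ≤ s) {p : ℕ} (hp : p.Prime) :
    |logFactor h κ s p - (h p - κ / p) * (p : ℝ) ^ (-s)| ≤ logFactorError C β κ p := by
  obtain ⟨hz0, hz1, hz2⟩ := inv_mul_rpow_neg_mem hs hp
  have h1 := abs_log_one_sub_add_le hz0 hz2
  have h2 := (hh.twist hs).abs_log_tsum_pow_sub_le hβ hp
  set z := (p : ℝ)⁻¹ * (p : ℝ) ^ (-s) with hz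
  have e : logFactor h κ s p - (h p - κ / p) * (p : ℝ) ^ (-s)
      = κ * (Real.log (1 - z) + z)
        + (Real.log (∑' k, _root_.twist h s (p ^ k)) - _root_.twist h s p) := by
    rw [logFactor, eulerFactor, hz, _root_.twist]; ring
  have hzsq : z ^ 2 ≤ ((p : ℝ) ^ (-1 : ℝ)) ^ 2 := by
    rw [Real.rpow_neg_one]
    exact pow_le_pow_left₀ hz0 hz1 2
  rw [e]
  refine (abs_add_le _ _).trans ?_
  rw [abs_mul, abs_of_nonneg hκ, logFactorError]
  have := mul_le_mul_of_nonneg_left (h1.trans (mul_le_mul_of_nonneg_left hzsq zero_le_two)) hκ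
  linarith

/-- The partial Euler products converge uniformly in `s ≥ 0`. -/
lemma exists_abs_logProd_sub_le (hh : IsPowBoundedMul h C β) (hβ : 1 / 2 < β) {κ A : ℝ}
    (hκ : 0 ≤ κ)
    (hA : ∀ w : ℝ, 1 ≤ w →
      |∑ p ∈ (Icc 1 ⌊w⌋₊).filter Nat.Prime, h p * Real.log p - κ * Real.log w| ≤ A) :
    ∃ ε : ℕ → ℝ, Tendsto ε atTop (nhds 0) ∧ ∀ s : ℝ, 0 ≤ s → ∀ N M : ℕ, 2 ≤ N → N ≤ M →
      |logProd h κ s M - logProd h κ s N| ≤ ε N := by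
  obtain ⟨A', hA'⟩ := exists_abs_sum_log_div_prime_sub_log_le
  have hE := summable_logFactorError (C := C) (κ := κ) hβ
  have hE0 := logFactorError_nonneg (β := β) (zero_le_one.trans hh.one_le_const) hκ
  set b : ℕ → ℝ := fun n => if n.Prime then (h n - κ / n) * Real.log n else 0 with hb
  have hA0 : 0 ≤ A := (abs_nonneg _).trans (hA 1 le_rfl)
  have hA'0 : 0 ≤ A' := (abs_nonneg _).trans (hA' 1 le_rfl)
  have hbsum : ∀ n, |∑ i ∈ range n, b i| ≤ A + κ * A' := by
    intro n
    rcases (show n = 0 ∨ n = 1 ∨ 2 ≤ n by lia) with rfl | rfl | hn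
    · simp; positivity
    · simp [hb, Nat.not_prime_zero]; positivity
    · obtain ⟨m, rfl⟩ : ∃ m, n = m + 1 := ⟨n - 1, by lia⟩
      have hm : 1 ≤ m := by lia
      have h1 := hA m (by exact_mod_cast hm)
      have h2 := mul_le_mul_of_nonneg_left (hA' m hm) hκ
      rw [← abs_of_nonneg hκ, ← abs_mul, abs_of_nonneg hκ] at h2
      rw [Nat.floor_natCast] at h1
      have e : ∑ i ∈ range (m + 1), b i
          = (∑ p ∈ (Icc 1 m).filter Nat.Prime, h p * Real.log p - κ * Real.log m)
            - κ * (∑ p ∈ (Icc 1 m).filter Nat.Prime, Real.log p / p - Real.log m) := by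
        have hset : (range (m + 1)).filter Nat.Prime = (Icc 1 m).filter Nat.Prime := by
          ext p
          simp only [mem_filter, mem_range, mem_Icc]
          refine and_congr_left fun hp => ?_
          have := hp.one_le
          lia
        rw [hb, ← sum_filter, hset, mul_sub, mul_sum]
        rw [sub_sub_sub_cancel_right, ← sum_sub_distrib]
        exact sum_congr rfl fun p _ => by ring
      rw [e]
      exact (abs_sub _ _).trans (add_le_add h1 h2)
  refine ⟨fun N => 2 * (A + κ * A') / Real.log N + ∑' k, logFactorError C β κ (k + N), ?_, ?_⟩
  · have h1 : Tendsto (fun N : ℕ => 2 * (A + κ * A') / Real.log N) atTop (nhds 0) :=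
      tendsto_const_nhds.div_atTop (Real.tendsto_log_atTop.comp tendsto_natCast_atTop_atTop)
    simpa using h1.add (tendsto_sum_nat_add (logFactorError C β κ))
  · intro s hs N M hN hNM
    set w : ℕ → ℝ := fun n => (n : ℝ) ^ (-s) / Real.log n with hw
    have hlog : ∀ n, N ≤ n → 0 < Real.log n := fun n hn =>
      Real.log_pos (by exact_mod_cast (show 1 < n by lia))
    have hw0 : ∀ n, N ≤ n → 0 ≤ w n := fun n hn => div_nonneg (by positivity) (hlog n hn).le
    have hw1 : ∀ n, N ≤ n → w (n + 1) ≤ w n := by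
      intro n hn
      have hn0 : (0 : ℝ) < n := by exact_mod_cast (show 0 < n by lia)
      have hle : (n : ℝ) ≤ (n + 1 : ℕ) := by push_cast; linarith
      refine div_le_div₀ (by positivity)
        (Real.rpow_le_rpow_of_nonpos hn0 hle (by linarith)) (hlog n hn)
        (Real.log_le_log hn0 hle)
    have habel := abs_sum_Ico_mul_le hbsum hw0 hw1 hNM
    have hwN : w N ≤ 1 / Real.log N := by
      refine div_le_div_of_nonneg_right ?_ (hlog N le_rfl).le
      exact Real.rpow_le_one_of_one_le_of_nonpos (by exact_mod_cast (show 1 ≤ N by lia))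
        (by linarith)
    have hdiff : logProd h κ s M - logProd h κ s N
        = ∑ n ∈ Ico N M, if n.Prime then logFactor h κ s n else 0 := by
      rw [sum_Ico_eq_sub _ hNM, logProd, logProd, Nat.primesBelow, Nat.primesBelow, sum_filter,
        sum_filter]
    have herr : |logProd h κ s M - logProd h κ s N - ∑ n ∈ Ico N M, b n * w n|
        ≤ ∑' k, logFactorError C β κ (k + N) := by
      rw [hdiff, ← sum_sub_distrib]
      refine (abs_sum_le_sum_abs _ _).trans ?_
      have : ∀ n ∈ Ico N M, |(if n.Prime then logFactor h κ s n else 0) - b n * w n|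
          ≤ logFactorError C β κ n := by
        intro n hn
        by_cases hp : n.Prime
        · have hl := (hlog n (mem_Ico.1 hn).1).ne'
          simp only [hb, hw, if_pos hp]
          rw [show (h n - κ / n) * Real.log n * ((n : ℝ) ^ (-s) / Real.log n)
            = (h n - κ / n) * (n : ℝ) ^ (-s) by field_simp]
          exact hh.abs_logFactor_sub_le (by linarith) hκ hs hp
        · simp [hb, hp, hE0 n]
      refine (sum_le_sum this).trans ?_
      rw [sum_Ico_eq_sum_range]
      simp_rw [add_comm N]
      exact ((summable_nat_add_iff N).2 hE).sum_le_tsum _ fun k _ => hE0 _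
    have hAw : 2 * (A + κ * A') * w N ≤ 2 * (A + κ * A') / Real.log N := by
      rw [div_eq_mul_one_div]
      exact mul_le_mul_of_nonneg_left hwN (by positivity)
    have := abs_add_le (logProd h κ s M - logProd h κ s N - ∑ n ∈ Ico N M, b n * w n)
      (∑ n ∈ Ico N M, b n * w n)
    rw [sub_add_cancel] at this
    linarith

end IsPowBoundedMul

lemma isPowBoundedMul_inv : IsPowBoundedMul (fun n : ℕ => (n : ℝ)⁻¹) 1 1 where
  zero := by simp
  one := by simp
  mul {m n} _ := by push_cast; rw [mul_inv]
  nonneg n := by positivity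
  pow_le p hp k := by rw [Real.rpow_neg_one]; simp

/-- `ζ (1 + s)` for real `s > 0`. -/
noncomputable def shiftedZeta (s : ℝ) : ℝ := ∑' n, twist (fun n : ℕ => (n : ℝ)⁻¹) s n

lemma twist_inv_eq {s : ℝ} (hs : 0 < s) (n : ℕ) :
    twist (fun n : ℕ => (n : ℝ)⁻¹) s n = 1 / (n : ℝ) ^ (s + 1) := by
  rcases Nat.eq_zero_or_pos n with rfl | hn
  · simp [twist, Real.zero_rpow (show s + 1 ≠ 0 by linarith)]
  · have hn0 : (0 : ℝ) < n := by exact_mod_cast hn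
    rw [twist, Real.rpow_add_one hn0.ne', Real.rpow_neg hn0.le]
    field_simp

lemma summable_twist_inv {s : ℝ} (hs : 0 < s) :
    Summable (twist (fun n : ℕ => (n : ℝ)⁻¹) s) := by
  simp_rw [funext (twist_inv_eq hs)]
  exact Real.summable_one_div_nat_rpow.2 (by linarith)

lemma tendsto_mul_shiftedZeta :
    Tendsto (fun s => s * shiftedZeta s) (nhdsWithin 0 (Set.Ioi 0)) (nhds 1) := by
  have h1 : Tendsto (fun s : ℝ => s + 1) (nhdsWithin 0 (Set.Ioi 0))
      (nhdsWithin 1 (Set.Ioi 1)) := by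
    refine tendsto_nhdsWithin_iff.2 ⟨?_, ?_⟩
    · exact Tendsto.mono_left (Continuous.tendsto' (by fun_prop) _ _ (by simp)) nhdsWithin_le_nhds
    · filter_upwards [self_mem_nhdsWithin] with s hs
      have : (0 : ℝ) < s := hs
      simpa using this
  refine (tendsto_sub_mul_tsum_nat_rpow.comp h1).congr' ?_
  filter_upwards [self_mem_nhdsWithin] with s hs
  simp only [Function.comp, add_sub_cancel_right, shiftedZeta]
  simp_rw [twist_inv_eq hs]

lemma shiftedZeta_nonneg (s : ℝ) : 0 ≤ shiftedZeta s :=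
  tsum_nonneg fun n => isPowBoundedMul_inv.twist_nonneg s n

lemma shiftedZeta_le_of_le {s t : ℝ} (hs : 0 < s) (hst : s ≤ t) :
    shiftedZeta t ≤ shiftedZeta s := by
  refine (summable_twist_inv (hs.trans_le hst)).tsum_le_tsum (fun n => ?_) (summable_twist_inv hs)
  rcases Nat.eq_zero_or_pos n with rfl | hn
  · simp [twist]
  · exact mul_le_mul_of_nonneg_left
      (Real.rpow_le_rpow_of_exponent_le (by exact_mod_cast hn) (by linarith)) (by positivity)

lemma exists_mul_shiftedZeta_le (S : ℝ) :
    ∃ Z, ∀ s, 0 < s → s ≤ S → s * shiftedZeta s ≤ Z := by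
  have h1 : ∀ᶠ s in nhdsWithin (0 : ℝ) (Set.Ioi 0), s * shiftedZeta s < 2 :=
    tendsto_mul_shiftedZeta.eventually_lt_const (by norm_num)
  obtain ⟨δ, hδ, hsub⟩ := mem_nhdsGT_iff_exists_Ioo_subset.1 h1
  refine ⟨max 2 (S * shiftedZeta δ), fun s hs hsS => ?_⟩
  rcases lt_or_ge s δ with h | h
  · exact (le_of_lt (hsub ⟨hs, h⟩)).trans (le_max_left _ _)
  · exact (mul_le_mul hsS (shiftedZeta_le_of_le hδ h) (shiftedZeta_nonneg s)
      (hs.le.trans hsS)).trans (le_max_right _ _)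

lemma eulerFactor_inv {s : ℝ} (hs : 0 ≤ s) {p : ℕ} (hp : p.Prime) :
    eulerFactor (fun n : ℕ => (n : ℝ)⁻¹) s p = (1 - (p : ℝ)⁻¹ * (p : ℝ) ^ (-s))⁻¹ := by
  obtain ⟨hz0, _, hz2⟩ := inv_mul_rpow_neg_mem hs hp
  rw [eulerFactor, ← tsum_geometric_of_lt_one hz0 (by linarith)]
  refine tsum_congr fun r => ?_
  rw [twist, mul_pow, Nat.cast_pow, inv_pow, ← Real.rpow_natCast ((p : ℝ) ^ (-s)),
    ← Real.rpow_natCast_mul (Nat.cast_nonneg p), ← Real.rpow_mul (Nat.cast_nonneg p),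
    mul_comm (r : ℝ)]

namespace IsPowBoundedMul

variable {h : ℕ → ℝ} {C β : ℝ}

lemma prod_eulerFactor_nonneg (hh : IsPowBoundedMul h C β) (hβ : 0 < β) {s : ℝ} (hs : 0 ≤ s)
    (N : ℕ) : 0 ≤ ∏ p ∈ N.primesBelow, eulerFactor h s p :=
  prod_nonneg fun _ hp => zero_le_one.trans
    (hh.one_le_eulerFactor hβ hs (Nat.prime_of_mem_primesBelow hp))

lemma exp_logProd (hh : IsPowBoundedMul h C β) (hβ : 0 < β) (κ : ℝ) {s : ℝ} (hs : 0 ≤ s)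
    (N : ℕ) :
    Real.exp (logProd h κ s N)
      = ∏ p ∈ N.primesBelow,
        (1 - (p : ℝ)⁻¹ * (p : ℝ) ^ (-s)) ^ κ * eulerFactor h s p := by
  rw [logProd, Real.exp_sum]
  refine prod_congr rfl fun p hp => ?_
  have hp' := Nat.prime_of_mem_primesBelow hp
  obtain ⟨_, _, hz2⟩ := inv_mul_rpow_neg_mem hs hp'
  rw [logFactor, Real.exp_add, Real.exp_log
    (zero_lt_one.trans_le (hh.one_le_eulerFactor hβ hs hp')),
    Real.rpow_def_of_pos (show 0 < 1 - (p : ℝ)⁻¹ * (p : ℝ) ^ (-s) by linarith) κ, mul_comm κ]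

lemma prod_eulerFactor_eq (hh : IsPowBoundedMul h C β) (hβ : 0 < β) (κ : ℝ) {s : ℝ}
    (hs : 0 ≤ s) (N : ℕ) :
    ∏ p ∈ N.primesBelow, eulerFactor h s p
      = Real.exp (logProd h κ s N) *
        (∏ p ∈ N.primesBelow, eulerFactor (fun n : ℕ => (n : ℝ)⁻¹) s p) ^ κ := by
  rw [hh.exp_logProd hβ κ hs, ← Real.finsetProd_rpow, ← prod_mul_distrib]
  · refine prod_congr rfl fun p hp => ?_
    have hp' := Nat.prime_of_mem_primesBelow hp
    obtain ⟨_, _, hz2⟩ := inv_mul_rpow_neg_mem hs hp'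
    have : 0 < (1 - (p : ℝ)⁻¹ * (p : ℝ) ^ (-s)) ^ κ := Real.rpow_pos_of_pos (by linarith) κ
    rw [eulerFactor_inv hs hp', Real.inv_rpow (by linarith), mul_right_comm,
      mul_inv_cancel₀ this.ne', one_mul]
  · exact fun p hp => zero_le_one.trans (isPowBoundedMul_inv.one_le_eulerFactor one_pos hs
      (Nat.prime_of_mem_primesBelow hp))

lemma sum_twist_le_prod (hh : IsPowBoundedMul h C β) (hβ : 0 < β) {s : ℝ} (hs : 0 ≤ s)
    (N : ℕ) :
    ∑ n ∈ Icc 1 N, _root_.twist h s n ≤ ∏ p ∈ (N + 1).primesBelow, eulerFactor h s p := by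
  have ht := hh.twist hs
  obtain ⟨hsum, hprod⟩ := EulerProduct.summable_and_hasSum_smoothNumbers_prod_primesBelow_tsum
    ht.one ht.mul (fun hp => (ht.summable_pow hβ hp).norm) (N + 1)
  have hmem : ∀ n ∈ Icc 1 N, n ∈ (N + 1).smoothNumbers := by
    intro n hn
    rw [mem_Icc] at hn
    exact Nat.mem_smoothNumbers_of_lt (by lia) (by lia)
  have hle := hprod.summable.sum_le_tsum ((Icc 1 N).subtype (· ∈ (N + 1).smoothNumbers))
    fun n _ => ht.nonneg n
  rw [hprod.tsum_eq, sum_subtype_of_mem _ hmem] at hle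
  exact hle

lemma tendsto_prod_eulerFactor (hh : IsPowBoundedMul h C β) {s : ℝ} (hs : 0 ≤ s)
    (hsum : Summable (_root_.twist h s)) :
    Tendsto (fun N => ∏ p ∈ Nat.primesBelow N, eulerFactor h s p) atTop
      (nhds (∑' n, _root_.twist h s n)) :=
  EulerProduct.eulerProduct (hh.twist hs).one (hh.twist hs).mul hsum.norm (hh.twist hs).zero

end IsPowBoundedMul

lemma prod_eulerFactor_inv_le {s : ℝ} (hs : 0 < s) (N : ℕ) :
    ∏ p ∈ N.primesBelow, eulerFactor (fun n : ℕ => (n : ℝ)⁻¹) s p ≤ shiftedZeta s := by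
  refine Monotone.ge_of_tendsto (monotone_nat_of_le_succ fun n => ?_)
    (isPowBoundedMul_inv.tendsto_prod_eulerFactor hs.le (summable_twist_inv hs)) N
  have hone : ∀ p ∈ (n + 1).primesBelow, 1 ≤ eulerFactor (fun n : ℕ => (n : ℝ)⁻¹) s p :=
    fun p hp => isPowBoundedMul_inv.one_le_eulerFactor one_pos hs.le
      (Nat.prime_of_mem_primesBelow hp)
  have hsub : n.primesBelow ⊆ (n + 1).primesBelow := fun p hp => by
    rw [Nat.mem_primesBelow] at hp ⊢
    exact ⟨by lia, hp.2⟩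
  exact prod_le_prod_of_subset_of_one_le hsub (fun p hp => zero_le_one.trans (hone p (hsub hp)))
    fun p hp _ => hone p hp

namespace IsPowBoundedMul

variable {h : ℕ → ℝ} {C β : ℝ}

lemma exists_sum_twist_le (hh : IsPowBoundedMul h C β) (hβ : 1 / 2 < β) {κ A : ℝ}
    (hκ : 0 ≤ κ)
    (hA : ∀ w : ℝ, 1 ≤ w →
      |∑ p ∈ (Icc 1 ⌊w⌋₊).filter Nat.Prime, h p * Real.log p - κ * Real.log w| ≤ A) :
    ∃ B, 0 ≤ B ∧ ∀ s, 0 < s → ∀ N : ℕ,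
      ∑ n ∈ Icc 1 N, _root_.twist h s n ≤ B * shiftedZeta s ^ κ := by
  obtain ⟨ε, -, hε⟩ := hh.exists_abs_logProd_sub_le hβ hκ hA
  refine ⟨Real.exp (ε 2), (Real.exp_pos _).le, fun s hs N => ?_⟩
  have hle : ∑ n ∈ Icc 1 N, _root_.twist h s n ≤ ∑ n ∈ Icc 1 (N + 1), _root_.twist h s n :=
    sum_le_sum_of_subset_of_nonneg (Icc_subset_Icc_right (Nat.le_succ N))
      fun n _ _ => hh.twist_nonneg s n
  refine (hle.trans (hh.sum_twist_le_prod (by linarith) hs.le (N + 1))).trans ?_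
  rw [hh.prod_eulerFactor_eq (by linarith) κ hs.le]
  have h2 : logProd h κ s 2 = 0 := by
    simp only [logProd, show Nat.primesBelow 2 = ∅ from by decide, sum_empty]
  have h1 := hε s hs.le 2 (N + 1 + 1) le_rfl (by lia)
  rw [h2, sub_zero] at h1
  gcongr
  · exact Real.rpow_nonneg (isPowBoundedMul_inv.prod_eulerFactor_nonneg one_pos hs.le _) κ
  · exact (le_abs_self _).trans h1
  · exact isPowBoundedMul_inv.prod_eulerFactor_nonneg one_pos hs.le _
  · exact prod_eulerFactor_inv_le hs _

lemma summable_twist (hh : IsPowBoundedMul h C β) (hβ : 1 / 2 < β) {κ A : ℝ}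
    (hκ : 0 ≤ κ)
    (hA : ∀ w : ℝ, 1 ≤ w →
      |∑ p ∈ (Icc 1 ⌊w⌋₊).filter Nat.Prime, h p * Real.log p - κ * Real.log w| ≤ A)
    {s : ℝ} (hs : 0 < s) : Summable (_root_.twist h s) := by
  obtain ⟨B, -, hB⟩ := hh.exists_sum_twist_le hβ hκ hA
  refine summable_of_sum_range_le (c := B * shiftedZeta s ^ κ) (hh.twist_nonneg s) fun n => ?_
  refine le_trans ?_ (hB s hs n)
  rw [← sum_subset (s₁ := (range n).filter (1 ≤ ·)) (filter_subset _ _)]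
  · refine sum_le_sum_of_subset_of_nonneg (fun k hk => ?_) fun k _ _ => hh.twist_nonneg s k
    simp only [mem_filter, mem_range, mem_Icc] at hk ⊢
    lia
  · intro k hk hk'
    have : k = 0 := by
      simp only [mem_filter, not_and] at hk'
      have := hk' hk
      lia
    simp [this, _root_.twist, hh.zero]

lemma exists_summatory_le (hh : IsPowBoundedMul h C β) (hβ : 1 / 2 < β) {κ A : ℝ}
    (hκ : 0 ≤ κ)
    (hA : ∀ w : ℝ, 1 ≤ w →
      |∑ p ∈ (Icc 1 ⌊w⌋₊).filter Nat.Prime, h p * Real.log p - κ * Real.log w| ≤ A) :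
    ∃ K, 0 ≤ K ∧ ∀ u, Real.log 2 ≤ u → summatory h ⌊Real.exp u⌋₊ ≤ K * u ^ κ := by
  obtain ⟨B, hB0, hB⟩ := hh.exists_sum_twist_le hβ hκ hA
  obtain ⟨Z, hZ⟩ := exists_mul_shiftedZeta_le (Real.log 2)⁻¹
  have hl2 : 0 < Real.log 2 := Real.log_pos (by norm_num)
  have hZ0 : 0 ≤ Z := (mul_nonneg (inv_pos.2 hl2).le (shiftedZeta_nonneg _)).trans
    (hZ _ (inv_pos.2 hl2) le_rfl)
  refine ⟨Real.exp 1 * (B * Z ^ κ), by positivity, fun u hu => ?_⟩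
  have hu0 : 0 < u := hl2.trans_le hu
  have hz : shiftedZeta u⁻¹ ≤ Z * u := by
    have := hZ u⁻¹ (inv_pos.2 hu0) (inv_anti₀ hl2 hu)
    rwa [inv_mul_le_iff₀ hu0, mul_comm] at this
  calc summatory h ⌊Real.exp u⌋₊
      ≤ ∑ n ∈ Icc 1 ⌊Real.exp u⌋₊, Real.exp 1 * _root_.twist h u⁻¹ n := by
        refine sum_le_sum fun n hn => ?_
        obtain ⟨hn1, hn2⟩ := mem_Icc_floor_exp.1 hn
        have hn0 : (0 : ℝ) < n := by exact_mod_cast hn1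
        have h1 : 1 ≤ Real.exp 1 * (n : ℝ) ^ (-u⁻¹) := by
          rw [Real.rpow_def_of_pos hn0, ← Real.exp_add, Real.one_le_exp_iff]
          have : Real.log n * u⁻¹ ≤ 1 := by rwa [← div_eq_mul_inv, div_le_one hu0]
          linarith
        rw [_root_.twist, mul_left_comm]
        exact le_mul_of_one_le_right (hh.nonneg n) h1
    _ = Real.exp 1 * ∑ n ∈ Icc 1 ⌊Real.exp u⌋₊, _root_.twist h u⁻¹ n := by rw [mul_sum]
    _ ≤ Real.exp 1 * (B * (Z * u) ^ κ) := by
        gcongr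
        refine (hB u⁻¹ (inv_pos.2 hu0) _).trans ?_
        gcongr
        exact shiftedZeta_nonneg _
    _ = Real.exp 1 * (B * Z ^ κ) * u ^ κ := by
        rw [Real.mul_rpow hZ0 hu0.le]; ring

lemma continuousOn_eulerFactor (hh : IsPowBoundedMul h C β) (hβ : 0 < β) {p : ℕ}
    (hp : p.Prime) : ContinuousOn (fun s => eulerFactor h s p) (Set.Ici 0) := by
  refine continuousOn_tsum (u := fun r => h (p ^ r)) (fun r => ?_) (hh.summable_pow hβ hp) ?_
  · refine ContinuousOn.mul continuousOn_const (Continuous.continuousOn ?_)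
    exact (Real.continuous_const_rpow (by exact_mod_cast (pow_pos hp.pos r).ne')).comp
      continuous_neg
  · intro r s hs
    have hs' : (0 : ℝ) ≤ s := hs
    rw [Real.norm_of_nonneg (hh.twist_nonneg s _)]
    refine mul_le_of_le_one_right (hh.nonneg _) (Real.rpow_le_one_of_one_le_of_nonpos ?_ ?_)
    · exact_mod_cast Nat.one_le_pow _ _ hp.pos
    · linarith

lemma continuousOn_logProd (hh : IsPowBoundedMul h C β) (hβ : 0 < β) (κ : ℝ) (N : ℕ) :
    ContinuousOn (fun s => logProd h κ s N) (Set.Ici 0) := by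
  refine continuousOn_finsetSum _ fun p hp => ?_
  have hp' := Nat.prime_of_mem_primesBelow hp
  refine ContinuousOn.add (continuousOn_const.mul (ContinuousOn.log ?_ fun s hs => ?_))
    ((hh.continuousOn_eulerFactor hβ hp').log fun s hs => ?_)
  · have : (p : ℝ) ≠ 0 := by exact_mod_cast hp'.ne_zero
    exact (continuous_const.sub
      (continuous_const.mul ((Real.continuous_const_rpow this).comp continuous_neg))).continuousOn
  · obtain ⟨_, _, hz2⟩ := inv_mul_rpow_neg_mem hs hp'
    exact (show 0 < 1 - (p : ℝ)⁻¹ * (p : ℝ) ^ (-s) by linarith).ne'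
  · exact (zero_lt_one.trans_le (hh.one_le_eulerFactor hβ hs hp')).ne'

lemma exists_tendsto_logProd (hh : IsPowBoundedMul h C β) (hβ : 1 / 2 < β) {κ A : ℝ}
    (hκ : 0 ≤ κ)
    (hA : ∀ w : ℝ, 1 ≤ w →
      |∑ p ∈ (Icc 1 ⌊w⌋₊).filter Nat.Prime, h p * Real.log p - κ * Real.log w| ≤ A) :
    ∃ L : ℝ → ℝ, ContinuousOn L (Set.Ici 0) ∧
      ∀ s, 0 ≤ s → Tendsto (logProd h κ s) atTop (nhds (L s)) := by
  obtain ⟨ε, hε0, hε⟩ := hh.exists_abs_logProd_sub_le hβ hκ hA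
  have hcauchy : UniformCauchySeqOn (fun N s => logProd h κ s N) atTop (Set.Ici 0) := by
    rw [Metric.uniformCauchySeqOn_iff]
    intro δ hδ
    obtain ⟨N, hN⟩ := (hε0.eventually_lt_const (half_pos hδ)).exists_forall_of_atTop
    refine ⟨max N 2, fun m hm n hn s hs => ?_⟩
    have h1 := hε s hs (max N 2) m (le_max_right _ _) hm
    have h2 := hε s hs (max N 2) n (le_max_right _ _) hn
    have h3 := hN (max N 2) (le_max_left _ _)
    rw [abs_le] at h1 h2
    rw [Real.dist_eq, abs_lt]
    constructor <;> linarith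
  have hlim : ∀ s : ℝ, 0 ≤ s → ∃ l, Tendsto (logProd h κ s) atTop (nhds l) := fun s hs =>
    cauchySeq_tendsto_of_complete (hcauchy.cauchySeq hs)
  choose! L hL using hlim
  exact ⟨L, (hcauchy.tendstoUniformlyOn_of_tendsto hL).continuousOn
    (Frequently.of_forall fun N => hh.continuousOn_logProd (by linarith) κ N), hL⟩

/-- The constant in an asymptotic `∑_{n ≤ e ^ u} h n ∼ c u ^ κ` is given by the Euler product. -/
lemma tendsto_prod_of_tendsto_div (hh : IsPowBoundedMul h C β) (hβ : 1 / 2 < β) {κ A c : ℝ}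
    (hκ : 0 ≤ κ)
    (hA : ∀ w : ℝ, 1 ≤ w →
      |∑ p ∈ (Icc 1 ⌊w⌋₊).filter Nat.Prime, h p * Real.log p - κ * Real.log w| ≤ A)
    (hlim : Tendsto (fun u => summatory h ⌊Real.exp u⌋₊ / u ^ κ) atTop (nhds c)) :
    Tendsto (fun N => ∏ p ∈ Nat.primesBelow N, (1 - (p : ℝ)⁻¹) ^ κ * ∑' r : ℕ, h (p ^ r))
      atTop (nhds (Real.Gamma (κ + 1) * c)) := by
  have hβ0 : 0 < β := by linarith
  obtain ⟨L, hLc, hL⟩ := hh.exists_tendsto_logProd hβ hκ hA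
  obtain ⟨K, hK0, hK⟩ := hh.exists_summatory_le hβ hκ hA
  have hsum : ∀ s, 0 < s → Summable (_root_.twist h s) := fun s hs => hh.summable_twist hβ hκ hA hs
  have hD : ∀ s, 0 < s → ∑' n, _root_.twist h s n = Real.exp (L s) * shiftedZeta s ^ κ := by
    intro s hs
    refine tendsto_nhds_unique (hh.tendsto_prod_eulerFactor hs.le (hsum s hs)) ?_
    simp_rw [hh.prod_eulerFactor_eq hβ0 κ hs.le]
    exact ((Real.continuous_exp.tendsto _).comp (hL s hs.le)).mul
      ((isPowBoundedMul_inv.tendsto_prod_eulerFactor hs.le (summable_twist_inv hs)).rpow_const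
        (Or.inr hκ))
  have h1 : Tendsto (fun s => s ^ κ * ∑' n, _root_.twist h s n) (nhdsWithin 0 (Set.Ioi 0))
      (nhds (Real.exp (L 0))) := by
    have hexp : Tendsto (fun s => Real.exp (L s)) (nhdsWithin 0 (Set.Ioi 0))
        (nhds (Real.exp (L 0))) :=
      (Real.continuous_exp.tendsto _).comp
        ((hLc 0 Set.self_mem_Ici).mono_left (nhdsWithin_mono _ Set.Ioi_subset_Ici_self))
    have := hexp.mul (tendsto_mul_shiftedZeta.rpow_const (p := κ) (Or.inr hκ))
    rw [Real.one_rpow, mul_one] at this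
    refine this.congr' ?_
    filter_upwards [self_mem_nhdsWithin] with s hs
    have hs' : (0 : ℝ) < s := hs
    rw [hD s hs', Real.mul_rpow hs'.le (shiftedZeta_nonneg s)]
    ring
  rw [← tendsto_nhds_unique h1 (hh.tendsto_rpow_mul_tsum_twist hκ hsum hK hlim)]
  refine ((Real.continuous_exp.tendsto _).comp (hL 0 le_rfl)).congr fun N => ?_
  simp [hh.exp_logProd hβ0 κ le_rfl, eulerFactor, _root_.twist]

end IsPowBoundedMul

namespace IsPowBoundedMul

variable {h : ℕ → ℝ} {C β : ℝ}

lemma exists_abs_summatory_sub_le_and_tendsto (hh : IsPowBoundedMul h C β) (hβ : 1 / 2 < β)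
    {κ A K : ℝ} (hκ : 0 ≤ κ)
    (hA : ∀ w : ℝ, 1 ≤ w →
      |∑ p ∈ (Icc 1 ⌊w⌋₊).filter Nat.Prime, h p * Real.log p - κ * Real.log w| ≤ A)
    (hK0 : 0 ≤ K) (hK : ∀ u, Real.log 2 ≤ u → summatory h ⌊Real.exp u⌋₊ ≤ K * u ^ κ) :
    ∃ c, (∀ u, Real.log 2 ≤ u → |summatory h ⌊Real.exp u⌋₊ - c * u ^ κ|
        ≤ (κ + 2) * ((A + primePowConst C β) * K) * u ^ (κ - 1)) ∧
      Tendsto (fun N => ∏ p ∈ Nat.primesBelow N, (1 - (p : ℝ)⁻¹) ^ κ * ∑' r : ℕ, h (p ^ r))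
        atTop (nhds (Real.Gamma (κ + 1) * c)) := by
  have hA0 : 0 ≤ A := (abs_nonneg _).trans (hA 1 le_rfl)
  have hP := primePowConst_nonneg (β := β) (zero_le_one.trans hh.one_le_const)
  obtain ⟨c, hc⟩ := exists_abs_summatory_sub_le hκ (by positivity) hK0
    (hh.abs_sum_log_sub_le hβ hA) hK
  refine ⟨c, hc, hh.tendsto_prod_of_tendsto_div hβ hκ hA ?_⟩
  have hl2 : 0 < Real.log 2 := Real.log_pos (by norm_num)
  rw [tendsto_iff_norm_sub_tendsto_zero]
  refine squeeze_zero' (g := fun u => (κ + 2) * ((A + primePowConst C β) * K) * u⁻¹)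
    (Eventually.of_forall fun u => norm_nonneg _) ?_ ?_
  · filter_upwards [eventually_ge_atTop (Real.log 2)] with u hu
    have hu0 : 0 < u := hl2.trans_le hu
    have hp : 0 < u ^ κ := Real.rpow_pos_of_pos hu0 κ
    have e : summatory h ⌊Real.exp u⌋₊ / u ^ κ - c
        = (summatory h ⌊Real.exp u⌋₊ - c * u ^ κ) / u ^ κ := by field_simp
    rw [e, Real.norm_eq_abs, abs_div, abs_of_pos hp, div_le_iff₀ hp]
    refine (hc u hu).trans_eq ?_
    rw [Real.rpow_sub_one hu0.ne']
    ring
  · simpa using tendsto_inv_atTop_zero.const_mul ((κ + 2) * ((A + primePowConst C β) * K))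

end IsPowBoundedMul

/-- The function `g n / n` restricted to the integers coprime to `q`. -/
noncomputable def coprimeDiv (g : ℕ → ℝ) (q n : ℕ) : ℝ := if n.Coprime q then g n / n else 0

section coprimeDiv

variable {g : ℕ → ℝ}

lemma isPowBoundedMul_coprimeDiv {C α : ℝ} (hg1 : g 1 = 1)
    (hmul : ∀ m n : ℕ, Nat.Coprime m n → g (m * n) = g m * g n) (hnn : ∀ n, 0 ≤ g n)
    (hbd : ∀ n : ℕ, 1 ≤ n → g n ≤ C * (n : ℝ) ^ α) (q : ℕ) :
    IsPowBoundedMul (coprimeDiv g q) C (1 - α) where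
  zero := by simp [coprimeDiv]
  one := by simp [coprimeDiv, hg1]
  mul {m n} hmn := by
    simp only [coprimeDiv, Nat.coprime_mul_iff_left, hmul m n hmn, Nat.cast_mul, mul_div_mul_comm]
    split_ifs <;> simp_all
  nonneg n := by
    unfold coprimeDiv
    split_ifs
    · exact div_nonneg (hnn n) n.cast_nonneg
    · exact le_rfl
  pow_le p hp k := by
    have hC : 0 ≤ C := by
      have := hbd 1 le_rfl
      rw [hg1, Nat.cast_one, Real.one_rpow, mul_one] at this
      linarith
    have hp0 : (0 : ℝ) < p := by exact_mod_cast hp.pos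
    unfold coprimeDiv
    split_ifs
    · rw [div_le_iff₀ (by exact_mod_cast pow_pos hp.pos k), Nat.cast_pow, mul_assoc, ← mul_pow,
        ← Real.rpow_add_one hp0.ne', show -(1 - α) + 1 = α by ring, ← Real.rpow_mul_natCast hp0.le,
        mul_comm α, Real.rpow_natCast_mul hp0.le, ← Nat.cast_pow]
      exact hbd _ (Nat.one_le_pow _ _ hp.pos)
    · positivity

lemma summatory_coprimeDiv (q N : ℕ) :
    summatory (coprimeDiv g q) N = ∑ n ∈ (Icc 1 N).filter (fun n => Nat.Coprime n q), g n / n :=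
  (sum_filter _ _).symm

lemma coprimeDiv_le_one (hnn : ∀ n, 0 ≤ g n) (q n : ℕ) :
    coprimeDiv g q n ≤ coprimeDiv g 1 n := by
  simp only [coprimeDiv, Nat.coprime_one_right_eq_true, if_true]
  split_ifs
  · exact le_rfl
  · exact div_nonneg (hnn n) n.cast_nonneg

lemma tsum_coprimeDiv_one_pow (p : ℕ) :
    ∑' r : ℕ, coprimeDiv g 1 (p ^ r) = ∑' r : ℕ, g (p ^ r) / (p : ℝ) ^ r := by
  simp [coprimeDiv]

lemma tsum_coprimeDiv_pow_of_dvd (hg1 : g 1 = 1) {p q : ℕ} (hp : p.Prime) (hpq : p ∣ q) :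
    ∑' r : ℕ, coprimeDiv g q (p ^ r) = 1 := by
  rw [tsum_eq_single 0 fun r hr => ?_]
  · simp [coprimeDiv, hg1]
  · rw [coprimeDiv, if_neg]
    rw [Nat.coprime_pow_left_iff (Nat.pos_of_ne_zero hr), hp.coprime_iff_not_dvd]
    exact not_not_intro hpq

lemma tsum_coprimeDiv_pow_of_not_dvd {p q : ℕ} (hp : p.Prime) (hpq : ¬p ∣ q) :
    ∑' r : ℕ, coprimeDiv g q (p ^ r) = ∑' r : ℕ, g (p ^ r) / (p : ℝ) ^ r :=
  tsum_congr fun r => by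
    rw [coprimeDiv, if_pos ((hp.coprime_iff_not_dvd.2 hpq).pow_left r), Nat.cast_pow]

/-- Removing the primes dividing `q` removes finitely many Euler factors. -/
lemma prod_coprimeDiv_mul (hg1 : g 1 = 1) (κ : ℝ) {q N : ℕ} (hq : 0 < q) (hN : q < N) :
    (∏ p ∈ Nat.primesBelow N, (1 - (p : ℝ)⁻¹) ^ κ * ∑' r : ℕ, coprimeDiv g q (p ^ r))
        * ∏ p ∈ q.primeFactors, ∑' r : ℕ, g (p ^ r) / (p : ℝ) ^ r
      = ∏ p ∈ Nat.primesBelow N, (1 - (p : ℝ)⁻¹) ^ κ * ∑' r : ℕ, coprimeDiv g 1 (p ^ r) := by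
  have hq' : q.primeFactors = (Nat.primesBelow N).filter (· ∣ q) := by
    ext p
    simp only [Nat.mem_primeFactors, mem_filter, Nat.mem_primesBelow]
    constructor
    · exact fun h => ⟨⟨(Nat.le_of_dvd hq h.2.1).trans_lt hN, h.1⟩, h.2.1⟩
    · exact fun h => ⟨h.1.2, h.2, hq.ne'⟩
  rw [hq', prod_filter, ← prod_mul_distrib]
  refine prod_congr rfl fun p hp => ?_
  have hp' := Nat.prime_of_mem_primesBelow hp
  rw [tsum_coprimeDiv_one_pow]
  split_ifs with hpq
  · rw [tsum_coprimeDiv_pow_of_dvd hg1 hp' hpq, mul_one]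
  · rw [tsum_coprimeDiv_pow_of_not_dvd hp' hpq, mul_one]

lemma abs_sum_coprimeDiv_mul_log_sub_le (hnn : ∀ n, 0 ≤ g n) {κ C : ℝ} (hκ : 0 ≤ κ)
    (hmertens : ∀ w : ℝ, 2 ≤ w →
      |(∑ p ∈ (range (⌊w⌋₊ + 1)).filter Nat.Prime, g p * Real.log p / p) - κ * Real.log w| ≤ C)
    {q : ℕ} (hq : 0 < q) {w : ℝ} (hw : 1 ≤ w) :
    |∑ p ∈ (Icc 1 ⌊w⌋₊).filter Nat.Prime, coprimeDiv g q p * Real.log p - κ * Real.log w|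
      ≤ (C + κ * Real.log 2 + 1) * (1 + ∑ p ∈ q.primeFactors, g p * Real.log p / p) := by
  have hC : 0 ≤ C := (abs_nonneg _).trans (hmertens 2 le_rfl)
  have hl2 : 0 < Real.log 2 := Real.log_pos (by norm_num)
  have hterm : ∀ p : ℕ, 0 ≤ g p * Real.log p / p := fun p =>
    div_nonneg (mul_nonneg (hnn p) (Real.log_natCast_nonneg p)) p.cast_nonneg
  have hD : 0 ≤ ∑ p ∈ q.primeFactors, g p * Real.log p / p := sum_nonneg fun p _ => hterm p
  suffices |∑ p ∈ (Icc 1 ⌊w⌋₊).filter Nat.Prime, coprimeDiv g q p * Real.log p - κ * Real.log w|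
      ≤ C + κ * Real.log 2 + ∑ p ∈ q.primeFactors, g p * Real.log p / p by
    nlinarith [mul_nonneg hC hD, mul_nonneg (mul_nonneg hκ hl2.le) hD]
  rcases lt_or_ge w 2 with hw2 | hw2
  · have h0 : (Icc 1 ⌊w⌋₊).filter Nat.Prime = ∅ := by
      refine filter_eq_empty_iff.2 fun p hp hpp => ?_
      have h1 : ⌊w⌋₊ < 2 := (Nat.floor_lt (by linarith)).2 (by exact_mod_cast hw2)
      have := hpp.two_le
      rw [mem_Icc] at hp
      lia
    have h1 : κ * Real.log w ≤ κ * Real.log 2 :=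
      mul_le_mul_of_nonneg_left (Real.log_le_log (by linarith) hw2.le) hκ
    rw [h0, sum_empty, zero_sub, abs_neg, abs_of_nonneg (mul_nonneg hκ (Real.log_nonneg hw))]
    linarith
  · have hset : (Icc 1 ⌊w⌋₊).filter Nat.Prime = (range (⌊w⌋₊ + 1)).filter Nat.Prime := by
      ext p
      simp only [mem_filter, mem_Icc, mem_range]
      exact ⟨fun h => ⟨by lia, h.2⟩, fun h => ⟨⟨h.2.one_le, by lia⟩, h.2⟩⟩
    rw [hset]
    set s := (range (⌊w⌋₊ + 1)).filter Nat.Prime with hs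
    have hle : ∑ p ∈ s, coprimeDiv g q p * Real.log p ≤ ∑ p ∈ s, g p * Real.log p / p := by
      refine sum_le_sum fun p _ => ?_
      unfold coprimeDiv
      split_ifs
      · exact (div_mul_eq_mul_div _ _ _).le
      · rw [zero_mul]; exact hterm p
    have hge : ∑ p ∈ s, g p * Real.log p / p - ∑ p ∈ s, coprimeDiv g q p * Real.log p
        ≤ ∑ p ∈ q.primeFactors, g p * Real.log p / p := by
      rw [← sum_sub_distrib]
      calc _ ≤ ∑ p ∈ s, if p ∣ q then g p * Real.log p / p else 0 := by
            refine sum_le_sum fun p hp => ?_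
            have hpp : p.Prime := (mem_filter.1 hp).2
            simp only [coprimeDiv, hpp.coprime_iff_not_dvd]
            by_cases hpq : p ∣ q
            · simp [hpq]
            · simp [hpq, div_mul_eq_mul_div]
        _ = ∑ p ∈ s.filter (· ∣ q), g p * Real.log p / p := (sum_filter _ _).symm
        _ ≤ _ := by
            refine sum_le_sum_of_subset_of_nonneg (fun p hp => ?_) fun p _ _ => hterm p
            rw [mem_filter, hs, mem_filter] at hp
            exact Nat.mem_primeFactors.2 ⟨hp.1.2, hp.2, hq.ne'⟩
    have hm := hmertens w hw2
    have := mul_nonneg hκ hl2.le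
    rw [abs_le] at hm ⊢
    constructor <;> linarith

end coprimeDiv

/-- Proposition C(b): with `g` nonnegative multiplicative,
`g(n) ≪ n^α` for `α < 1/2`, and `∑_{p≤x} g(p)(log p)/p = κ log x + O(1)`,
uniformly for `x ≥ 2` and positive integers `q`,
`∑_{n≤x,(n,q)=1} g(n)/n = c_q(g)(log x)^κ + O(δ(q)(log x)^{κ−1})`, where
`c_q(g) = c(g) ∏_{p∣q}(1 + g(p)/p + ⋯)⁻¹` and `δ(q) = 1 + ∑_{p∣q} g(p)(log p)/p`. -/
theorem stmt_16 (g : ℕ → ℝ) (hg1 : g 1 = 1)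
    (hmul : ∀ m n : ℕ, Nat.Coprime m n → g (m * n) = g m * g n)
    (hnn : ∀ n, 0 ≤ g n) (α : ℝ) (hα : α < 1 / 2)
    (hbd : ∃ C : ℝ, ∀ n : ℕ, 1 ≤ n → g n ≤ C * (n : ℝ) ^ α)
    (κ : ℝ) (hκ : 0 ≤ κ)
    (hmertens : ∃ C : ℝ, ∀ w : ℝ, 2 ≤ w →
      |(∑ p ∈ (Finset.range (⌊w⌋₊ + 1)).filter Nat.Prime,
          g p * Real.log p / p) - κ * Real.log w| ≤ C) :
    ∃ c : ℝ,
      Tendsto (fun N : ℕ =>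
          ∏ p ∈ (Finset.range N).filter Nat.Prime,
            (1 - 1 / (p : ℝ)) ^ κ * ∑' r : ℕ, g (p ^ r) / ((p : ℝ) ^ r))
        atTop (nhds (Real.Gamma (κ + 1) * c)) ∧
      ∃ C : ℝ, ∀ q : ℕ, 0 < q → ∀ x : ℝ, 2 ≤ x →
        |(∑ n ∈ (Finset.Icc 1 ⌊x⌋₊).filter (fun n => Nat.Coprime n q), g n / n)
            - (c * ∏ p ∈ q.primeFactors, (∑' r : ℕ, g (p ^ r) / ((p : ℝ) ^ r))⁻¹)
                * Real.log x ^ κ|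
          ≤ C * (1 + ∑ p ∈ q.primeFactors, g p * Real.log p / p)
              * Real.log x ^ (κ - 1) := by
  obtain ⟨C, hC⟩ := hbd
  obtain ⟨M, hM⟩ := hmertens
  have hβ : 1 / 2 < 1 - α := by linarith
  have hh := isPowBoundedMul_coprimeDiv hg1 hmul hnn hC
  have hA : ∀ q : ℕ, 0 < q → ∀ w : ℝ, 1 ≤ w → _ := fun q hq w hw =>
    abs_sum_coprimeDiv_mul_log_sub_le hnn hκ hM hq hw
  obtain ⟨K, hK0, hK⟩ := (hh 1).exists_summatory_le hβ hκ (hA 1 one_pos)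
  have hKq : ∀ q u, Real.log 2 ≤ u → summatory (coprimeDiv g q) ⌊Real.exp u⌋₊ ≤ K * u ^ κ :=
    fun q u hu => (sum_le_sum fun n _ => coprimeDiv_le_one hnn q n).trans (hK u hu)
  have hmain := fun q hq =>
    (hh q).exists_abs_summatory_sub_le_and_tendsto hβ hκ (hA q hq) hK0 (hKq q)
  obtain ⟨c, -, hc⟩ := hmain 1 one_pos
  have hP := primePowConst_nonneg (β := 1 - α) (zero_le_one.trans (hh 1).one_le_const)
  refine ⟨c, ?_, (κ + 2) * ((M + κ * Real.log 2 + 1 + primePowConst C (1 - α)) * K),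
    fun q hq x hx => ?_⟩
  · refine hc.congr fun N => ?_
    simp only [Nat.primesBelow, tsum_coprimeDiv_one_pow, one_div]
  obtain ⟨cq, hbound, hcq⟩ := hmain q hq
  have hF : ∀ p ∈ q.primeFactors, ∑' r : ℕ, g (p ^ r) / (p : ℝ) ^ r ≠ 0 := fun p hp => by
    rw [← tsum_coprimeDiv_one_pow]
    exact (zero_lt_one.trans_le ((hh 1).one_le_tsum_pow (by linarith)
      (Nat.prime_of_mem_primeFactors hp))).ne'
  have hΓ : Real.Gamma (κ + 1) ≠ 0 := (Real.Gamma_pos_of_pos (by linarith)).ne'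
  have hcqc : cq * ∏ p ∈ q.primeFactors, ∑' r : ℕ, g (p ^ r) / (p : ℝ) ^ r = c := by
    have h1 := hcq.mul_const (∏ p ∈ q.primeFactors, ∑' r : ℕ, g (p ^ r) / (p : ℝ) ^ r)
    have h2 := tendsto_nhds_unique (h1.congr' ((eventually_gt_atTop q).mono fun N hN =>
      prod_coprimeDiv_mul hg1 κ hq hN)) hc
    rw [mul_assoc] at h2
    exact mul_left_cancel₀ hΓ h2
  have hcq' : c * ∏ p ∈ q.primeFactors, (∑' r : ℕ, g (p ^ r) / (p : ℝ) ^ r)⁻¹ = cq := by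
    rw [← hcqc, prod_inv_distrib, mul_inv_cancel_right₀ (prod_ne_zero_iff.2 hF)]
  have hx0 : 0 < x := by linarith
  have hux : Real.log 2 ≤ Real.log x := Real.log_le_log (by norm_num) hx
  have hb := hbound (Real.log x) hux
  rw [Real.exp_log hx0, summatory_coprimeDiv] at hb
  rw [hcq']
  refine hb.trans ?_
  have hδ : 1 ≤ 1 + ∑ p ∈ q.primeFactors, g p * Real.log p / p :=
    le_add_of_nonneg_right (sum_nonneg fun p _ =>
      div_nonneg (mul_nonneg (hnn p) (Real.log_natCast_nonneg p)) p.cast_nonneg)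
  have hu0 : 0 ≤ Real.log x := Real.log_nonneg (by linarith)
  refine mul_le_mul_of_nonneg_right ?_ (Real.rpow_nonneg hu0 _)
  rw [mul_assoc, mul_right_comm _ K]
  gcongr
  rw [add_mul _ (primePowConst C (1 - α))]
  gcongr
  exact le_mul_of_one_le_right hP hδ
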